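/- arXiv:1707.02253 — 4 statements merged into one kernel-verified Lean document; each statement's English description precedes it below -/
import Mathlib

section
/- Let X have the beta' density f̃_{d,β} on ℝ^d with β > d/2, and let E_h^- = {x ∈ ℝ^d : x_d ≤ h} for h ∈ ℝ. Then P(X ∈ E_h^-) = F̃_{1,β-(d-1)/2}(h), where F̃_{1,γ}(h) = c̃_{1,γ}∫_{-∞}^h (1+x²)^{-γ} dx. -/
open MeasureTheory

theorem integrable_exp_neg_mul_norm_sq {V : Type*} [NormedAddCommGroup V] [InnerProductSpace ℝ V]
    [FiniteDimensional ℝ V] [MeasurableSpace V] [BorelSpace V] {b : ℝ} (hb : 0 < b) :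
    Integrable fun v : V ↦ Real.exp (-b * ‖v‖ ^ 2) := by
  refine not_imp_comm.1 integral_undef ?_
  rw [GaussianFourier.integral_rexp_neg_mul_sq_norm hb]
  positivity

theorem integral_rpow_mul_exp_neg_mul_add_norm_sq {V : Type*} [NormedAddCommGroup V]
    [InnerProductSpace ℝ V] [FiniteDimensional ℝ V] [MeasurableSpace V] [BorelSpace V]
    {β c u : ℝ} (hu : 0 < u) :
    ∫ y : V, u ^ (β - 1) * Real.exp (-((c + ‖y‖ ^ 2) * u)) =
      Real.pi ^ ((Module.finrank ℝ V : ℝ) / 2) *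
        (u ^ (β - (Module.finrank ℝ V : ℝ) / 2 - 1) * Real.exp (-(c * u))) := by
  have h (y : V) : u ^ (β - 1) * Real.exp (-((c + ‖y‖ ^ 2) * u)) =
      u ^ (β - 1) * Real.exp (-(c * u)) * Real.exp (-u * ‖y‖ ^ 2) := by
    rw [mul_assoc, ← Real.exp_add]
    ring_nf
  simp_rw [h]
  rw [integral_const_mul, GaussianFourier.integral_rexp_neg_mul_sq_norm hu,
    Real.div_rpow Real.pi_pos.le hu.le,
    show β - (Module.finrank ℝ V : ℝ) / 2 - 1 = β - 1 - (Module.finrank ℝ V : ℝ) / 2 by ring,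
    Real.rpow_sub hu (β - 1)]
  ring

theorem integrable_prod_rpow_mul_exp_neg_mul_add_norm_sq {V : Type*} [NormedAddCommGroup V]
    [InnerProductSpace ℝ V] [FiniteDimensional ℝ V] [MeasurableSpace V] [BorelSpace V]
    {β c : ℝ} (hβ : (Module.finrank ℝ V : ℝ) / 2 < β) (hc : 0 < c) :
    Integrable (Function.uncurry fun (u : ℝ) (y : V) ↦
        u ^ (β - 1) * Real.exp (-((c + ‖y‖ ^ 2) * u)))
      ((volume.restrict (Set.Ioi 0)).prod volume) := by
  rw [integrable_prod_iff (by
    apply Measurable.aestronglyMeasurable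
    unfold Function.uncurry
    fun_prop)]
  constructor
  · filter_upwards [ae_restrict_mem measurableSet_Ioi] with u (hu : 0 < u)
    refine ((integrable_exp_neg_mul_norm_sq (V := V) hu).const_mul
      (u ^ (β - 1) * Real.exp (-(c * u)))).congr (.of_forall fun y ↦ ?_)
    simp only [Function.uncurry]
    rw [mul_assoc, ← Real.exp_add]
    ring_nf
  · have hint := (integrableOn_rpow_mul_exp_neg_mul_rpow
      (s := β - (Module.finrank ℝ V : ℝ) / 2 - 1) (by linarith) one_pos hc).const_mul
        (Real.pi ^ ((Module.finrank ℝ V : ℝ) / 2))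
    refine hint.congr ?_
    filter_upwards [ae_restrict_mem measurableSet_Ioi] with u (hu : 0 < u)
    simp only [Function.uncurry]
    rw [Real.rpow_one, neg_mul, ← integral_rpow_mul_exp_neg_mul_add_norm_sq hu]
    refine integral_congr_ae (.of_forall fun y ↦ ?_)
    exact (Real.norm_of_nonneg (by positivity)).symm

theorem integral_add_norm_sq_rpow_neg {V : Type*} [NormedAddCommGroup V]
    [InnerProductSpace ℝ V] [FiniteDimensional ℝ V] [MeasurableSpace V] [BorelSpace V]
    {β c : ℝ} (hβ : (Module.finrank ℝ V : ℝ) / 2 < β) (hc : 0 < c) :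
    ∫ y : V, (c + ‖y‖ ^ 2) ^ (-β) =
      Real.pi ^ ((Module.finrank ℝ V : ℝ) / 2) *
        Real.Gamma (β - (Module.finrank ℝ V : ℝ) / 2) / Real.Gamma β *
          c ^ (-(β - (Module.finrank ℝ V : ℝ) / 2)) := by
  have hβ0 : 0 < β := lt_of_le_of_lt (by positivity) hβ
  have hΓ := (Real.Gamma_pos_of_pos hβ0).ne'
  have hswap := integral_integral_swap
    (integrable_prod_rpow_mul_exp_neg_mul_add_norm_sq (V := V) hβ hc)
  have hleft := setIntegral_congr_fun (μ := volume) measurableSet_Ioi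
    fun u (hu : u ∈ Set.Ioi (0 : ℝ)) ↦
      integral_rpow_mul_exp_neg_mul_add_norm_sq (V := V) (β := β) (c := c) hu
  have hright (y : V) : ∫ u in Set.Ioi (0 : ℝ), u ^ (β - 1) * Real.exp (-((c + ‖y‖ ^ 2) * u)) =
      (c + ‖y‖ ^ 2) ^ (-β) * Real.Gamma β := by
    have hy : 0 < c + ‖y‖ ^ 2 := by positivity
    rw [Real.integral_rpow_mul_exp_neg_mul_Ioi hβ0 hy, one_div, Real.inv_rpow hy.le,
      Real.rpow_neg hy.le]
  rw [hleft, integral_const_mul, Real.integral_rpow_mul_exp_neg_mul_Ioi (by linarith) hc] at hswap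
  simp_rw [hright] at hswap
  rw [integral_mul_const, one_div, Real.inv_rpow hc.le, ← Real.rpow_neg hc.le] at hswap
  rw [eq_div_of_mul_eq hΓ hswap.symm]
  ring

/-- Splitting off the last coordinate of a Euclidean space. -/
noncomputable def euclideanSnocEquiv (n : ℕ) :
    ℝ × EuclideanSpace ℝ (Fin n) ≃ᵐ EuclideanSpace ℝ (Fin (n + 1)) :=
  ((MeasurableEquiv.refl ℝ).prodCongr (MeasurableEquiv.toLp 2 (Fin n → ℝ)).symm).trans <|
    (MeasurableEquiv.piFinSuccAbove (fun _ ↦ ℝ) (Fin.last n)).symm.trans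
      (MeasurableEquiv.toLp 2 (Fin (n + 1) → ℝ))

theorem measurePreserving_euclideanSnocEquiv (n : ℕ) :
    MeasurePreserving (euclideanSnocEquiv n) :=
  (PiLp.volume_preserving_toLp (Fin (n + 1))).comp <|
    (volume_preserving_piFinSuccAbove (fun _ ↦ ℝ) (Fin.last n)).symm.comp <|
      (MeasurePreserving.id volume).prod (PiLp.volume_preserving_ofLp (Fin n))

theorem euclideanSnocEquiv_apply_last (n : ℕ) (p : ℝ × EuclideanSpace ℝ (Fin n)) :
    euclideanSnocEquiv n p (Fin.last n) = p.1 := by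
  change (Fin.last n).insertNth (α := fun _ ↦ ℝ) p.1 (fun j ↦ p.2 j) (Fin.last n) = p.1
  simp

theorem euclideanSnocEquiv_apply_castSucc (n : ℕ) (p : ℝ × EuclideanSpace ℝ (Fin n)) (i : Fin n) :
    euclideanSnocEquiv n p i.castSucc = p.2 i := by
  change (Fin.last n).insertNth (α := fun _ ↦ ℝ) p.1 (fun j ↦ p.2 j) i.castSucc = p.2 i
  simp

theorem norm_sq_euclideanSnocEquiv (n : ℕ) (p : ℝ × EuclideanSpace ℝ (Fin n)) :
    ‖euclideanSnocEquiv n p‖ ^ 2 = p.1 ^ 2 + ‖p.2‖ ^ 2 := by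
  rw [EuclideanSpace.real_norm_sq_eq, Fin.sum_univ_castSucc, EuclideanSpace.real_norm_sq_eq]
  simp_rw [euclideanSnocEquiv_apply_last, euclideanSnocEquiv_apply_castSucc]
  ring

theorem setIntegral_halfspace_one_add_norm_sq_rpow_neg (n : ℕ) {β : ℝ}
    (hβ : ((n + 1 : ℕ) : ℝ) / 2 < β) (h : ℝ) :
    ∫ x in {x : EuclideanSpace ℝ (Fin (n + 1)) | x (Fin.last n) ≤ h}, (1 + ‖x‖ ^ 2) ^ (-β) =
      Real.pi ^ ((n : ℝ) / 2) * Real.Gamma (β - (n : ℝ) / 2) / Real.Gamma β *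
        ∫ t in Set.Iic h, (1 + t ^ 2) ^ (-(β - (n : ℝ) / 2)) := by
  have hmp := measurePreserving_euclideanSnocEquiv n
  have hemb := (euclideanSnocEquiv n).measurableEmbedding
  have hint : Integrable fun x : EuclideanSpace ℝ (Fin (n + 1)) ↦ (1 + ‖x‖ ^ 2) ^ (-β) := by
    have := integrable_rpow_neg_one_add_norm_sq (E := EuclideanSpace ℝ (Fin (n + 1)))
      (μ := volume) (r := 2 * β) (by rw [finrank_euclideanSpace_fin]; linarith)
    rwa [show -(2 * β) / 2 = -β by ring] at this
  have hint' := (hmp.integrable_comp_emb hemb).2 hint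
  have hset : euclideanSnocEquiv n ⁻¹' {x | x (Fin.last n) ≤ h} = Set.Iic h ×ˢ Set.univ := by
    ext p
    simp [euclideanSnocEquiv_apply_last]
  have hinner (t : ℝ) := integral_add_norm_sq_rpow_neg (V := EuclideanSpace ℝ (Fin n))
    (β := β) (c := 1 + t ^ 2)
    (by rw [finrank_euclideanSpace_fin]; push_cast at hβ; linarith) (by positivity)
  rw [← hmp.setIntegral_preimage_emb hemb, hset, Measure.volume_eq_prod,
    setIntegral_prod (fun p ↦ (1 + ‖euclideanSnocEquiv n p‖ ^ 2) ^ (-β)) hint'.integrableOn, ← integral_const_mul]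
  simp_rw [norm_sq_euclideanSnocEquiv, setIntegral_univ, ← add_assoc, hinner,
    finrank_euclideanSpace_fin]

/-- Probability content of the half-space `{x_d ≤ h}` under the beta' distribution. -/
theorem betaPrime_halfspace_content (d : ℕ) (hd : 1 ≤ d) (β : ℝ) (hβ : (d : ℝ) / 2 < β)
    (h : ℝ) :
    ∫ x in {x : EuclideanSpace ℝ (Fin d) | x ⟨d - 1, by omega⟩ ≤ h},
      (Real.Gamma β / (Real.pi ^ ((d : ℝ) / 2) * Real.Gamma (β - (d : ℝ) / 2))) *
        (1 + ‖x‖ ^ 2) ^ (-β)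
    = (Real.Gamma (β - ((d : ℝ) - 1) / 2) /
          (Real.sqrt Real.pi * Real.Gamma ((β - ((d : ℝ) - 1) / 2) - 1 / 2))) *
        ∫ t in Set.Iic h, (1 + t ^ 2) ^ (-(β - ((d : ℝ) - 1) / 2)) := by
  obtain ⟨n, rfl⟩ := Nat.exists_eq_add_of_le' hd
  have hΓ := (Real.Gamma_pos_of_pos (lt_of_le_of_lt (by positivity) hβ)).ne'
  have hΓ' := (Real.Gamma_pos_of_pos (sub_pos.2 hβ)).ne'
  have hpi : Real.pi ^ (((n + 1 : ℕ) : ℝ) / 2) = Real.pi ^ ((n : ℝ) / 2) * √Real.pi := by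
    rw [Real.sqrt_eq_rpow, ← Real.rpow_add Real.pi_pos]
    push_cast
    ring_nf
  have hn : ((n + 1 : ℕ) : ℝ) - 1 = n := by push_cast; ring
  rw [integral_const_mul, hn, hpi,
    show β - (n : ℝ) / 2 - 1 / 2 = β - ((n + 1 : ℕ) : ℝ) / 2 by push_cast; ring]
  refine (congrArg _ (setIntegral_halfspace_one_add_norm_sq_rpow_neg n hβ h)).trans ?_
  have hpi0 : Real.pi ^ ((n : ℝ) / 2) ≠ 0 := (Real.rpow_pos_of_pos Real.pi_pos _).ne'
  field_simp
end

section
/- Let X_1,...,X_d be i.i.d. random points in ℝ^d, each distributed according to the beta density f_{d,β} on the unit ball with β > -1, and let ∇_d denote the d-dimensional volume of the parallelotope spanned by X_1,...,X_d (i.e. the absolute value of the determinant of the matrix with columns X_1,...,X_d). Then for every κ ≥ 0, E[∇_d^κ] = (Γ(β+d/2+1)/Γ(β+(d+κ)/2+1))^d · ∏_{i=1}^d Γ((d+κ-i+1)/2)/Γ((d-i+1)/2). -/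
open MeasureTheory

/-- The Euler beta integral as a lower Lebesgue integral. -/
lemma lintegral_Ioo_rpow_mul_one_sub_rpow {a b : ℝ} (ha : 0 < a) (hb : 0 < b) :
    ∫⁻ v in Set.Ioo (0 : ℝ) 1, ENNReal.ofReal (v ^ (a - 1) * (1 - v) ^ (b - 1)) =
      ENNReal.ofReal (ProbabilityTheory.beta a b) := by
  have hB := ProbabilityTheory.beta_pos ha hb
  have h := ProbabilityTheory.lintegral_betaPDF_eq_one ha hb
  rw [ProbabilityTheory.lintegral_betaPDF] at h
  have h2 : ∀ v : ℝ, ENNReal.ofReal (v ^ (a - 1) * (1 - v) ^ (b - 1)) =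
      ENNReal.ofReal (ProbabilityTheory.beta a b) *
        ENNReal.ofReal (1 / ProbabilityTheory.beta a b * v ^ (a - 1) * (1 - v) ^ (b - 1)) := by
    intro v
    rw [← ENNReal.ofReal_mul hB.le]
    congr 1
    field_simp
  simp_rw [h2]
  rw [lintegral_const_mul' _ _ ENNReal.ofReal_ne_top, h, mul_one]

lemma lintegral_Ioi_pow_mul_rpow_mul_one_sub_sq_rpow (n : ℕ) {κ β : ℝ} (hκ : 0 ≤ κ)
    (hβ : -1 < β) :
    ∫⁻ y in Set.Ioi (0 : ℝ), ENNReal.ofReal (y ^ n) *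
        ENNReal.ofReal (if y < 1 then y ^ κ * (1 - y ^ 2) ^ β else 0) =
      ENNReal.ofReal (ProbabilityTheory.beta ((n + 1 + κ) / 2) (β + 1) / 2) := by
  have hn : (0 : ℝ) ≤ n := n.cast_nonneg
  have ha : 0 < (n + 1 + κ) / 2 := by linarith
  have himg : (fun y : ℝ => y ^ 2) '' Set.Ioo 0 1 = Set.Ioo 0 1 := by
    ext v
    constructor
    · rintro ⟨y, ⟨h0, h1⟩, rfl⟩
      exact ⟨by positivity, by simpa using pow_lt_one₀ h0.le h1 two_ne_zero⟩
    · rintro ⟨h0, h1⟩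
      exact ⟨√v, ⟨Real.sqrt_pos.2 h0, (Real.sqrt_lt' one_pos).2 (by simpa)⟩,
        Real.sq_sqrt h0.le⟩
  have hinj : Set.InjOn (fun y : ℝ => y ^ 2) (Set.Ioo 0 1) := fun x hx y hy h =>
    (pow_left_inj₀ hx.1.le hy.1.le two_ne_zero).1 h
  have hsub := lintegral_image_eq_lintegral_abs_deriv_mul measurableSet_Ioo
    (fun x (_ : x ∈ Set.Ioo (0 : ℝ) 1) => (hasDerivAt_pow 2 x).hasDerivWithinAt) hinj
    (fun v => ENNReal.ofReal (v ^ ((n + 1 + κ) / 2 - 1) * (1 - v) ^ (β + 1 - 1)))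
  rw [himg, lintegral_Ioo_rpow_mul_one_sub_rpow ha (by linarith)] at hsub
  rw [ENNReal.ofReal_div_of_pos two_pos, hsub, ENNReal.ofReal_ofNat, div_eq_mul_inv,
    mul_comm _ (2⁻¹ : ENNReal), ← lintegral_const_mul' _ _ (by simp), ← Set.Ioi_inter_Iio, Set.inter_comm,
    ← Measure.restrict_restrict measurableSet_Iio, ← lintegral_indicator measurableSet_Iio]
  refine setLIntegral_congr_fun measurableSet_Ioi fun y (hy : 0 < y) => ?_
  by_cases h1 : y < 1
  · rw [Set.indicator_of_mem (show y ∈ Set.Iio 1 from h1), if_pos h1,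
      ← ENNReal.ofReal_mul (by positivity), ← ENNReal.ofReal_mul (by positivity)]
    rw [show (2⁻¹ : ENNReal) = ENNReal.ofReal 2⁻¹ by
      rw [ENNReal.ofReal_inv_of_pos two_pos, ENNReal.ofReal_ofNat],
      ← ENNReal.ofReal_mul (by positivity)]
    congr 1
    have e : (y ^ 2) ^ ((n + 1 + κ) / 2 - 1) * y = y ^ n * y ^ κ := by
      rw [← Real.rpow_natCast y 2, ← Real.rpow_mul hy.le, ← Real.rpow_add_one hy.ne',
        ← Real.rpow_natCast y n, ← Real.rpow_add hy]
      congr 1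
      push_cast
      ring
    have : |(2 : ℕ) * y ^ (2 - 1)| = 2 * y := by
      rw [abs_of_nonneg (by positivity)]; norm_num
    simp only [add_sub_cancel_right]
    rw [this, ← mul_assoc, ← e]
    ring
  · rw [Set.indicator_of_notMem (by simpa using h1), if_neg h1]
    simp

/-- Polar coordinates for the lower Lebesgue integral of a radial function. -/
lemma lintegral_fun_norm_addHaar {E : Type*} [NormedAddCommGroup E] [NormedSpace ℝ E]
    [Nontrivial E] [FiniteDimensional ℝ E] [MeasurableSpace E] [BorelSpace E]
    (μ : Measure E) [μ.IsAddHaarMeasure] {f : ℝ → ENNReal} (hf : Measurable f) :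
    ∫⁻ x, f ‖x‖ ∂μ = Module.finrank ℝ E * μ (Metric.ball 0 1) *
      ∫⁻ y in Set.Ioi (0 : ℝ), ENNReal.ofReal (y ^ (Module.finrank ℝ E - 1)) * f y :=
  calc
    ∫⁻ x, f ‖x‖ ∂μ = ∫⁻ x : ({(0)}ᶜ : Set E), f ‖x.1‖ ∂(μ.comap (↑)) := by
      rw [lintegral_subtype_comap (measurableSet_singleton _).compl fun x => f ‖x‖,
        restrict_compl_singleton]
    _ = ∫⁻ x, f x.2 ∂μ.toSphere.prod (.volumeIoiPow (Module.finrank ℝ E - 1)) := by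
      simpa using μ.measurePreserving_homeomorphUnitSphereProd.lintegral_comp_emb
        (Homeomorph.measurableEmbedding _) (f ∘ Subtype.val ∘ Prod.snd)
    _ = μ.toSphere Set.univ *
        ∫⁻ x : Set.Ioi (0 : ℝ), f x ∂.volumeIoiPow (Module.finrank ℝ E - 1) := by
      rw [lintegral_prod _ (by fun_prop)]
      simp [mul_comm]
    _ = _ := by
      rw [μ.toSphere_apply_univ, Measure.volumeIoiPow,
        lintegral_withDensity_eq_lintegral_mul _ (by fun_prop) (by fun_prop)]
      congr 1
      exact lintegral_subtype_comap measurableSet_Ioi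
        fun y : ℝ => ENNReal.ofReal (y ^ (Module.finrank ℝ E - 1)) * f y

lemma lintegral_norm_rpow_mul_one_sub_norm_sq_rpow {E : Type*} [NormedAddCommGroup E]
    [NormedSpace ℝ E] [Nontrivial E] [FiniteDimensional ℝ E] [MeasurableSpace E] [BorelSpace E]
    (μ : Measure E) [μ.IsAddHaarMeasure] {κ β : ℝ} (hκ : 0 ≤ κ) (hβ : -1 < β) :
    ∫⁻ x, ENNReal.ofReal (if ‖x‖ < 1 then ‖x‖ ^ κ * (1 - ‖x‖ ^ 2) ^ β else 0) ∂μ =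
      Module.finrank ℝ E * μ (Metric.ball 0 1) *
        ENNReal.ofReal (ProbabilityTheory.beta ((Module.finrank ℝ E + κ) / 2) (β + 1) / 2) := by
  have hd : 1 ≤ Module.finrank ℝ E := Module.finrank_pos
  rw [lintegral_fun_norm_addHaar μ
    (f := fun y => ENNReal.ofReal (if y < 1 then y ^ κ * (1 - y ^ 2) ^ β else 0))
    (ENNReal.measurable_ofReal.comp
      (Measurable.ite measurableSet_Iio (by fun_prop) (by fun_prop))),
    lintegral_Ioi_pow_mul_rpow_mul_one_sub_sq_rpow _ hκ hβ]
  push_cast [hd]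
  ring_nf

lemma lintegral_one_sub_sq_rpow {β : ℝ} (hβ : -1 < β) :
    ∫⁻ t : ℝ, ENNReal.ofReal (if t ^ 2 < 1 then (1 - t ^ 2) ^ β else 0) =
      ENNReal.ofReal (ProbabilityTheory.beta (1 / 2) (β + 1)) := by
  have h := lintegral_norm_rpow_mul_one_sub_norm_sq_rpow (volume : Measure ℝ) le_rfl hβ
  simp only [Real.norm_eq_abs, Real.rpow_zero, one_mul, sq_abs, Module.finrank_self,
    Real.volume_ball, ← sq_lt_one_iff_abs_lt_one] at h
  rw [h]
  norm_num
  rw [← ENNReal.ofReal_ofNat, ← ENNReal.ofReal_mul (by norm_num)]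
  congr 1
  ring

lemma lintegral_one_sub_sq_sub_rpow {β : ℝ} (hβ : -1 < β) (q : ℝ) :
    ∫⁻ t : ℝ, ENNReal.ofReal (if t ^ 2 + q < 1 then (1 - (t ^ 2 + q)) ^ β else 0) =
      ENNReal.ofReal (if q < 1 then
        ProbabilityTheory.beta (1 / 2) (β + 1) * (1 - q) ^ (β + 1 / 2) else 0) := by
  by_cases hq : q < 1
  · have hr : 0 < √(1 - q) := Real.sqrt_pos.2 (by linarith)
    have hr2 : √(1 - q) ^ 2 = 1 - q := Real.sq_sqrt (by linarith)
    have hsub := lintegral_image_eq_lintegral_abs_deriv_mul MeasurableSet.univ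
      (fun x (_ : x ∈ (Set.univ : Set ℝ)) =>
        ((hasDerivAt_id x).const_mul √(1 - q)).hasDerivWithinAt)
      (mul_right_injective₀ hr.ne').injOn
      (fun t => ENNReal.ofReal (if t ^ 2 + q < 1 then (1 - (t ^ 2 + q)) ^ β else 0))
    simp only [id] at hsub
    rw [Set.image_univ, (mul_left_surjective₀ hr.ne').range_eq, Measure.restrict_univ] at hsub
    rw [hsub, if_pos hq, mul_comm (ProbabilityTheory.beta _ _),
      ENNReal.ofReal_mul (Real.rpow_nonneg (by linarith) _), ← lintegral_one_sub_sq_rpow hβ,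
      ← lintegral_const_mul' _ _ ENNReal.ofReal_ne_top]
    refine lintegral_congr fun t => ?_
    rw [← ENNReal.ofReal_mul (abs_nonneg _),
      ← ENNReal.ofReal_mul (Real.rpow_nonneg (by linarith) _)]
    congr 1
    have e : (√(1 - q) * t) ^ 2 + q = 1 - (1 - q) * (1 - t ^ 2) := by
      rw [mul_pow, hr2]; ring
    simp only [e]
    have hiff : 1 - (1 - q) * (1 - t ^ 2) < 1 ↔ t ^ 2 < 1 := by
      rw [sub_lt_self_iff, mul_pos_iff_of_pos_left (by linarith), sub_pos]
    simp only [hiff]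
    split_ifs with ht
    · rw [sub_sub_cancel, Real.mul_rpow (by linarith) (by linarith), mul_one,
        abs_of_pos hr, Real.rpow_add (by linarith), Real.sqrt_eq_rpow]
      ring
    · simp
  · rw [if_neg hq, lintegral_congr (g := fun _ => 0)]
    · simp
    · intro t
      rw [if_neg (by nlinarith [sq_nonneg t])]
      simp

/-- The density of the `d`-dimensional beta distribution with parameter `β`. -/
noncomputable def betaBallPDFReal (d : ℕ) (β : ℝ) (x : EuclideanSpace ℝ (Fin d)) : ℝ :=
  if ‖x‖ < 1 then
    (Real.Gamma ((d : ℝ) / 2 + β + 1) / (Real.pi ^ ((d : ℝ) / 2) * Real.Gamma (β + 1))) *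
      (1 - ‖x‖ ^ 2) ^ β
  else 0

/-- The `d`-dimensional beta distribution with parameter `β` on the unit ball. -/
noncomputable def betaBallMeasure (d : ℕ) (β : ℝ) : Measure (EuclideanSpace ℝ (Fin d)) :=
  volume.withDensity fun x => ENNReal.ofReal (betaBallPDFReal d β x)

@[fun_prop]
lemma measurable_betaBallPDFReal (d : ℕ) (β : ℝ) : Measurable (betaBallPDFReal d β) :=
  Measurable.ite (measurableSet_lt measurable_norm measurable_const) (by fun_prop) (by fun_prop)

instance (d : ℕ) (β : ℝ) : SigmaFinite (betaBallMeasure d β) := by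
  unfold betaBallMeasure
  infer_instance

lemma betaBallPDFReal_const_nonneg (d : ℕ) {β : ℝ} (hβ : -1 < β) :
    0 ≤ Real.Gamma ((d : ℝ) / 2 + β + 1) /
      (Real.pi ^ ((d : ℝ) / 2) * Real.Gamma (β + 1)) := by
  have := Real.Gamma_pos_of_pos (show 0 < β + 1 by linarith)
  have := Real.Gamma_pos_of_pos (show 0 < (d : ℝ) / 2 + β + 1 by
    have : (0 : ℝ) ≤ d := d.cast_nonneg
    linarith)
  have := Real.pi_pos
  positivity

lemma betaBallPDFReal_nonneg (d : ℕ) {β : ℝ} (hβ : -1 < β) (x : EuclideanSpace ℝ (Fin d)) :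
    0 ≤ betaBallPDFReal d β x := by
  unfold betaBallPDFReal
  split_ifs with h
  · exact mul_nonneg (betaBallPDFReal_const_nonneg d hβ)
      (Real.rpow_nonneg (by nlinarith [norm_nonneg x]) _)
  · rfl

lemma lintegral_norm_rpow_betaBallMeasure {d : ℕ} (hd : d ≠ 0) {κ β : ℝ} (hκ : 0 ≤ κ)
    (hβ : -1 < β) :
    ∫⁻ x, ENNReal.ofReal (‖x‖ ^ κ) ∂betaBallMeasure d β =
      ENNReal.ofReal (Real.Gamma (((d : ℝ) + κ) / 2) / Real.Gamma ((d : ℝ) / 2) *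
        (Real.Gamma (β + (d : ℝ) / 2 + 1) / Real.Gamma (β + ((d : ℝ) + κ) / 2 + 1))) := by
  have : Nonempty (Fin d) := Fin.pos_iff_nonempty.1 (Nat.pos_of_ne_zero hd)
  have hd0 : (0 : ℝ) < d := Nat.cast_pos.2 (Nat.pos_of_ne_zero hd)
  have hc := betaBallPDFReal_const_nonneg d hβ
  set c := Real.Gamma ((d : ℝ) / 2 + β + 1) /
    (Real.pi ^ ((d : ℝ) / 2) * Real.Gamma (β + 1)) with hc_def
  have h : ∀ x : EuclideanSpace ℝ (Fin d),
      ENNReal.ofReal (betaBallPDFReal d β x) * ENNReal.ofReal (‖x‖ ^ κ) =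
      ENNReal.ofReal c *
        ENNReal.ofReal (if ‖x‖ < 1 then ‖x‖ ^ κ * (1 - ‖x‖ ^ 2) ^ β else 0) := by
    intro x
    rw [← ENNReal.ofReal_mul (betaBallPDFReal_nonneg d hβ x), ← ENNReal.ofReal_mul hc]
    congr 1
    unfold betaBallPDFReal
    split_ifs
    · ring
    · simp
  rw [betaBallMeasure, lintegral_withDensity_eq_lintegral_mul _ (by fun_prop) (by fun_prop)]
  simp only [Pi.mul_apply, h]
  rw [lintegral_const_mul' _ _ ENNReal.ofReal_ne_top,
    lintegral_norm_rpow_mul_one_sub_norm_sq_rpow _ hκ hβ, EuclideanSpace.volume_ball,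
    finrank_euclideanSpace_fin, Fintype.card_fin, ENNReal.ofReal_one, one_pow, one_mul,
    ← ENNReal.ofReal_natCast,
    ← ENNReal.ofReal_mul hd0.le, ← ENNReal.ofReal_mul, ← ENNReal.ofReal_mul hc]
  · congr 1
    have hG := Real.Gamma_add_one (s := (d : ℝ) / 2) (by positivity)
    have h1 := Real.Gamma_pos_of_pos (show 0 < β + 1 by linarith)
    have h2 := Real.Gamma_pos_of_pos (show 0 < (d : ℝ) / 2 by positivity)
    have h3 := Real.Gamma_pos_of_pos (show 0 < β + ((d : ℝ) + κ) / 2 + 1 by linarith)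
    have hp := Real.rpow_pos_of_pos Real.pi_pos ((d : ℝ) / 2)
    have hpi : √Real.pi ^ d = Real.pi ^ ((d : ℝ) / 2) := by
      rw [Real.sqrt_eq_rpow, ← Real.rpow_mul_natCast Real.pi_pos.le]
      ring_nf
    rw [hpi, hG, ProbabilityTheory.beta, hc_def,
      show (d : ℝ) / 2 + β + 1 = β + (d : ℝ) / 2 + 1 by ring,
      show ((d : ℝ) + κ) / 2 + (β + 1) = β + ((d : ℝ) + κ) / 2 + 1 by ring]
    field_simp
  · have := Real.Gamma_pos_of_pos (show 0 < (d : ℝ) / 2 + 1 by positivity)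
    positivity

/-- Forgetting the first coordinate of a vector. -/
noncomputable def euclideanTail (n : ℕ) (x : EuclideanSpace ℝ (Fin (n + 1))) :
    EuclideanSpace ℝ (Fin n) :=
  WithLp.toLp 2 fun i => x i.succ

lemma norm_sq_eq_zero_add_euclideanTail {n : ℕ} (x : EuclideanSpace ℝ (Fin (n + 1))) :
    ‖x‖ ^ 2 = x 0 ^ 2 + ‖euclideanTail n x‖ ^ 2 := by
  simp [EuclideanSpace.norm_sq_eq, Fin.sum_univ_succ, euclideanTail]

lemma measurePreserving_zero_euclideanTail (n : ℕ) :
    MeasurePreserving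
      (fun x : EuclideanSpace ℝ (Fin (n + 1)) => (x 0, euclideanTail n x)) := by
  have h := ((MeasurePreserving.id (volume : Measure ℝ)).prod
    (PiLp.volume_preserving_toLp (Fin n))).comp
    ((volume_preserving_piFinSuccAbove (fun _ : Fin (n + 1) => ℝ) 0).comp
      (PiLp.volume_preserving_ofLp (Fin (n + 1))))
  exact h

/-- Projecting a beta distribution along a coordinate raises its parameter by `1 / 2`. -/
lemma measurePreserving_euclideanTail_betaBallMeasure (n : ℕ) {β : ℝ} (hβ : -1 < β) :
    MeasurePreserving (euclideanTail n) (betaBallMeasure (n + 1) β)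
      (betaBallMeasure n (β + 1 / 2)) := by
  have hP := measurePreserving_zero_euclideanTail n
  have hm : Measurable (euclideanTail n) := hP.measurable.snd
  refine ⟨hm, Measure.ext_of_lintegral _ fun F hF => ?_⟩
  set c := Real.Gamma (((n + 1 : ℕ) : ℝ) / 2 + β + 1) /
    (Real.pi ^ (((n + 1 : ℕ) : ℝ) / 2) * Real.Gamma (β + 1)) with hc_def
  have hc : 0 ≤ c := betaBallPDFReal_const_nonneg (n + 1) hβ
  have h : ∀ x : EuclideanSpace ℝ (Fin (n + 1)),
      ENNReal.ofReal (betaBallPDFReal (n + 1) β x) * F (euclideanTail n x) =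
      F (euclideanTail n x) * ENNReal.ofReal c * ENNReal.ofReal
        (if x 0 ^ 2 + ‖euclideanTail n x‖ ^ 2 < 1 then
          (1 - (x 0 ^ 2 + ‖euclideanTail n x‖ ^ 2)) ^ β else 0) := by
    intro x
    rw [mul_assoc, ← ENNReal.ofReal_mul hc, mul_comm]
    congr 2
    unfold betaBallPDFReal
    rw [← norm_sq_eq_zero_add_euclideanTail]
    simp only [sq_lt_one_iff₀ (norm_nonneg x), mul_ite, mul_zero, hc_def]
  have hm2 : Measurable fun p : ℝ × EuclideanSpace ℝ (Fin n) =>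
      F p.2 * ENNReal.ofReal c * ENNReal.ofReal
        (if p.1 ^ 2 + ‖p.2‖ ^ 2 < 1 then (1 - (p.1 ^ 2 + ‖p.2‖ ^ 2)) ^ β else 0) := by
    refine Measurable.mul (by fun_prop) (ENNReal.measurable_ofReal.comp
      (Measurable.ite (measurableSet_lt (by fun_prop) measurable_const)
        (by fun_prop) (by fun_prop)))
  rw [lintegral_map hF hm, betaBallMeasure, betaBallMeasure,
    lintegral_withDensity_eq_lintegral_mul _ (by fun_prop) (by fun_prop),
    lintegral_withDensity_eq_lintegral_mul _ (by fun_prop) (by fun_prop)]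
  simp only [Pi.mul_apply, h]
  rw [hP.lintegral_comp hm2, Measure.volume_eq_prod, lintegral_prod_symm _ hm2.aemeasurable]
  refine lintegral_congr fun z => ?_
  have hm1 : Measurable fun t : ℝ => ENNReal.ofReal
      (if t ^ 2 + ‖z‖ ^ 2 < 1 then (1 - (t ^ 2 + ‖z‖ ^ 2)) ^ β else 0) :=
    ENNReal.measurable_ofReal.comp (Measurable.ite
      (measurableSet_lt (by fun_prop) measurable_const) (by fun_prop) (by fun_prop))
  simp only
  rw [lintegral_const_mul _ hm1, lintegral_one_sub_sq_sub_rpow hβ, mul_assoc, mul_comm,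
    ← ENNReal.ofReal_mul hc]
  congr 2
  unfold betaBallPDFReal
  simp only [sq_lt_one_iff₀ (norm_nonneg z)]
  split_ifs
  · have h1 := Real.Gamma_pos_of_pos (show 0 < β + 1 by linarith)
    have h2 := Real.Gamma_pos_of_pos (show 0 < β + 1 / 2 + 1 by linarith)
    have hp := Real.rpow_pos_of_pos Real.pi_pos ((n : ℝ) / 2)
    have hpi : Real.pi ^ (((n + 1 : ℕ) : ℝ) / 2) = Real.pi ^ ((n : ℝ) / 2) * √Real.pi := by
      rw [Real.sqrt_eq_rpow, ← Real.rpow_add Real.pi_pos]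
      push_cast
      ring_nf
    have hs := Real.sqrt_pos.2 Real.pi_pos
    rw [← mul_assoc]
    congr 1
    rw [hc_def, hpi, ProbabilityTheory.beta, Real.Gamma_one_half_eq,
      show (((n + 1 : ℕ) : ℝ) / 2 + β + 1) = (n : ℝ) / 2 + (β + 1 / 2) + 1 by push_cast; ring,
      show 1 / 2 + (β + 1) = β + 1 / 2 + 1 by ring]
    field_simp
  · simp

lemma measurePreserving_linearIsometryEquiv_betaBallMeasure (d : ℕ) (β : ℝ)
    (L : EuclideanSpace ℝ (Fin d) ≃ₗᵢ[ℝ] EuclideanSpace ℝ (Fin d)) :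
    MeasurePreserving L (betaBallMeasure d β) (betaBallMeasure d β) := by
  have hL := L.measurePreserving
  refine ⟨hL.measurable, Measure.ext_of_lintegral _ fun F hF => ?_⟩
  have hFL : Measurable fun x => F (L x) := hF.comp hL.measurable
  rw [lintegral_map hF hL.measurable, betaBallMeasure,
    lintegral_withDensity_eq_lintegral_mul _ (by fun_prop) hFL,
    lintegral_withDensity_eq_lintegral_mul _ (by fun_prop) hF,
    ← hL.lintegral_comp (f := (fun x => ENNReal.ofReal (betaBallPDFReal d β x)) * F)
      (by fun_prop)]
  refine lintegral_congr fun x => ?_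
  simp [betaBallPDFReal]

/-- The volume of the parallelotope spanned by `d` vectors in `ℝ^d`. -/
noncomputable def parallelotopeVolume {d : ℕ} (X : Fin d → EuclideanSpace ℝ (Fin d)) : ℝ :=
  |(Matrix.of fun i j : Fin d => X j i).det|

lemma parallelotopeVolume_nonneg {d : ℕ} (X : Fin d → EuclideanSpace ℝ (Fin d)) :
    0 ≤ parallelotopeVolume X :=
  abs_nonneg _

lemma continuous_parallelotopeVolume (d : ℕ) :
    Continuous (parallelotopeVolume (d := d)) := by
  unfold parallelotopeVolume
  refine continuous_abs.comp (Continuous.matrix_det ?_)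
  exact continuous_matrix fun i j => by simp only [Matrix.of_apply]; fun_prop

lemma parallelotopeVolume_comp_linearIsometryEquiv {d : ℕ}
    (L : EuclideanSpace ℝ (Fin d) ≃ₗᵢ[ℝ] EuclideanSpace ℝ (Fin d))
    (X : Fin d → EuclideanSpace ℝ (Fin d)) :
    parallelotopeVolume (fun i => L (X i)) = parallelotopeVolume X := by
  have hdet : ∀ Y : Fin d → EuclideanSpace ℝ (Fin d),
      parallelotopeVolume Y = |(EuclideanSpace.basisFun (Fin d) ℝ).toBasis.det Y| := by
    intro Y
    rw [Module.Basis.det_apply, parallelotopeVolume]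
    congr 2
  have h1 := L.toLinearIsometry.normDet_eq_one
  rw [LinearMap.normDet_eq_norm_det, Real.norm_eq_abs] at h1
  have h2 := (EuclideanSpace.basisFun (Fin d) ℝ).toBasis.det_comp L.toLinearIsometry.toLinearMap X
  rw [hdet, hdet]
  change |(EuclideanSpace.basisFun (Fin d) ℝ).toBasis.det
    (L.toLinearIsometry.toLinearMap ∘ X)| = _
  rw [h2, abs_mul, h1, one_mul]

lemma parallelotopeVolume_cons_single {n : ℕ} (r : ℝ)
    (Y : Fin n → EuclideanSpace ℝ (Fin (n + 1))) :
    parallelotopeVolume (Fin.cons (EuclideanSpace.single 0 r) Y : Fin (n + 1) → _) =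
      |r| * parallelotopeVolume fun i => euclideanTail n (Y i) := by
  unfold parallelotopeVolume
  rw [Matrix.det_succ_column_zero, Fin.sum_univ_succ, Finset.sum_eq_zero]
  · simp only [Matrix.of_apply, Fin.cons_zero, Fin.val_zero, pow_zero, one_mul, add_zero, abs_mul]
    congr 2
  · intro i _
    simp

lemma exists_linearIsometryEquiv_eq_single {n : ℕ} (x : EuclideanSpace ℝ (Fin (n + 1))) :
    ∃ L : EuclideanSpace ℝ (Fin (n + 1)) ≃ₗᵢ[ℝ] EuclideanSpace ℝ (Fin (n + 1)),
      L x = EuclideanSpace.single 0 ‖x‖ :=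
  ⟨_, Submodule.reflection_sub (by simp)⟩

/-- Moments of the volume of the random parallelotope spanned by beta-distributed points. -/
lemma lintegral_parallelotopeVolume_rpow {κ : ℝ} (hκ : 0 ≤ κ) (d : ℕ) {β : ℝ} (hβ : -1 < β) :
    ∫⁻ X, ENNReal.ofReal (parallelotopeVolume X ^ κ)
        ∂Measure.pi (fun _ : Fin d => betaBallMeasure d β) =
      ENNReal.ofReal (
        (Real.Gamma (β + (d : ℝ) / 2 + 1) / Real.Gamma (β + ((d : ℝ) + κ) / 2 + 1)) ^ d *
        ∏ i : Fin d, Real.Gamma (((d : ℝ) - (i : ℕ) + κ) / 2) /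
          Real.Gamma (((d : ℝ) - (i : ℕ)) / 2)) := by
  induction d generalizing β with
  | zero => simp [parallelotopeVolume]
  | succ n ih =>
    have hm : ∀ d : ℕ, Measurable fun X : Fin d → EuclideanSpace ℝ (Fin d) =>
        ENNReal.ofReal (parallelotopeVolume X ^ κ) := fun d =>
      ((continuous_parallelotopeVolume d).measurable.pow_const κ).ennreal_ofReal
    have hsplit := (measurePreserving_piFinSuccAbove
      (fun _ : Fin (n + 1) => betaBallMeasure (n + 1) β) 0).symm
    have hms : Measurable fun p => ENNReal.ofReal (parallelotopeVolume
        ((MeasurableEquiv.piFinSuccAbove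
          (fun _ : Fin (n + 1) => EuclideanSpace ℝ (Fin (n + 1))) 0).symm p) ^ κ) :=
      (hm _).comp hsplit.measurable
    rw [← hsplit.lintegral_comp (hm _), lintegral_prod _ hms.aemeasurable]
    have hinner : ∀ x : EuclideanSpace ℝ (Fin (n + 1)),
        ∫⁻ Y, ENNReal.ofReal (parallelotopeVolume
            ((MeasurableEquiv.piFinSuccAbove
              (fun _ : Fin (n + 1) => EuclideanSpace ℝ (Fin (n + 1))) 0).symm (x, Y)) ^ κ)
          ∂Measure.pi (fun _ : Fin n => betaBallMeasure (n + 1) β) =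
        ENNReal.ofReal (‖x‖ ^ κ) *
          ∫⁻ Z, ENNReal.ofReal (parallelotopeVolume Z ^ κ)
            ∂Measure.pi (fun _ : Fin n => betaBallMeasure n (β + 1 / 2)) := by
      intro x
      obtain ⟨L, hL⟩ := exists_linearIsometryEquiv_eq_single x
      have hP := measurePreserving_pi (fun _ : Fin n => betaBallMeasure (n + 1) β)
        (fun _ : Fin n => betaBallMeasure n (β + 1 / 2)) fun _ =>
        (measurePreserving_euclideanTail_betaBallMeasure n hβ).comp
          (measurePreserving_linearIsometryEquiv_betaBallMeasure (n + 1) β L)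
      rw [← hP.lintegral_comp (hm n), ← lintegral_const_mul' _ _ ENNReal.ofReal_ne_top]
      refine lintegral_congr fun Y => ?_
      rw [← ENNReal.ofReal_mul (by positivity),
        ← Real.mul_rpow (norm_nonneg x) (parallelotopeVolume_nonneg _),
        ← parallelotopeVolume_comp_linearIsometryEquiv L]
      congr 2
      rw [← abs_of_nonneg (norm_nonneg x)]
      refine Eq.trans ?_ (parallelotopeVolume_cons_single ‖x‖ fun i => L (Y i))
      congr 1
      funext i
      refine Fin.cases ?_ (fun j => ?_) i
      · simpa using hL
      · simp [MeasurableEquiv.piFinSuccAbove]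
    refine (lintegral_congr hinner).trans ?_
    rw [lintegral_mul_const _ (by fun_prop), ih (by linarith),
      lintegral_norm_rpow_betaBallMeasure n.succ_ne_zero hκ hβ, ← ENNReal.ofReal_mul]
    · congr 1
      rw [Fin.prod_univ_succ, pow_succ]
      push_cast
      have e1 : β + 1 / 2 + (n : ℝ) / 2 + 1 = β + ((n : ℝ) + 1) / 2 + 1 := by ring
      have e2 : β + 1 / 2 + ((n : ℝ) + κ) / 2 + 1 = β + ((n : ℝ) + 1 + κ) / 2 + 1 := by ring
      simp only [Fin.val_zero, Fin.val_succ, Nat.cast_zero, Nat.cast_add, Nat.cast_one, sub_zero,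
        add_sub_add_right_eq_sub, e1, e2]
      ring
    · have hn : (0 : ℝ) ≤ n := n.cast_nonneg
      have h1 := Real.Gamma_pos_of_pos (show 0 < (((n + 1 : ℕ) : ℝ) + κ) / 2 by
        push_cast; positivity)
      have h2 := Real.Gamma_pos_of_pos (show 0 < ((n + 1 : ℕ) : ℝ) / 2 by positivity)
      have h3 := Real.Gamma_pos_of_pos (show 0 < β + ((n + 1 : ℕ) : ℝ) / 2 + 1 by
        push_cast; linarith)
      have h4 := Real.Gamma_pos_of_pos (show 0 < β + (((n + 1 : ℕ) : ℝ) + κ) / 2 + 1 by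
        push_cast; linarith)
      positivity

/-- Integration against a finite power of a measure with density. -/
lemma lintegral_pi_withDensity {E : Type*} [MeasurableSpace E] (μ : Measure E) [SigmaFinite μ]
    {f : E → ENNReal} (hf : Measurable f) [SigmaFinite (μ.withDensity f)] (n : ℕ)
    {G : (Fin n → E) → ENNReal} (hG : Measurable G) :
    ∫⁻ X, G X ∂Measure.pi (fun _ : Fin n => μ.withDensity f) =
      ∫⁻ X, G X * ∏ i, f (X i) ∂Measure.pi (fun _ : Fin n => μ) := by
  induction n with
  | zero => simp [Measure.pi_of_empty (fun _ : Fin 0 => _)]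
  | succ n ih =>
    have h1 := (measurePreserving_piFinSuccAbove (fun _ : Fin (n + 1) => μ.withDensity f) 0).symm
    have h2 := (measurePreserving_piFinSuccAbove (fun _ : Fin (n + 1) => μ) 0).symm
    have hG2 : Measurable fun X : Fin (n + 1) → E => G X * ∏ i, f (X i) := by fun_prop
    have hG1 : Measurable fun p =>
        G ((MeasurableEquiv.piFinSuccAbove (fun _ : Fin (n + 1) => E) 0).symm p) :=
      hG.comp h1.measurable
    have hG3 : Measurable fun p =>
        G ((MeasurableEquiv.piFinSuccAbove (fun _ : Fin (n + 1) => E) 0).symm p) *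
          ∏ i, f ((MeasurableEquiv.piFinSuccAbove (fun _ : Fin (n + 1) => E) 0).symm p i) :=
      hG2.comp h2.measurable
    rw [← h1.lintegral_comp hG, ← h2.lintegral_comp hG2, lintegral_prod _ hG1.aemeasurable,
      lintegral_prod _ hG3.aemeasurable,
      lintegral_withDensity_eq_lintegral_mul _ hf hG1.lintegral_prod_right']
    refine lintegral_congr fun x => ?_
    have hGx := hG.comp (h1.measurable.comp (measurable_prodMk_left (x := x)))
    have hi := ih hGx
    simp only [Function.comp_def] at hi
    rw [Pi.mul_apply]
    refine (congrArg (f x * ·) hi).trans ?_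
    rw [← lintegral_const_mul _ (by fun_prop)]
    refine lintegral_congr fun Y => ?_
    simp [Fin.prod_univ_succ, MeasurableEquiv.piFinSuccAbove]
    ring

/-- Mathai's formula: moments of the volume of the random parallelotope spanned by `d`
i.i.d. beta-distributed points in the unit ball of `ℝ^d`. -/
theorem beta_parallelotope_moments (d : ℕ) (hd : 1 ≤ d) (β : ℝ) (hβ : -1 < β)
    (κ : ℝ) (hκ : 0 ≤ κ) :
    ∫ X : Fin d → EuclideanSpace ℝ (Fin d),
      |(Matrix.of fun i j : Fin d => X j i).det| ^ κ *
        ∏ i : Fin d,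
          (if ‖X i‖ < 1 then
            (Real.Gamma ((d : ℝ) / 2 + β + 1) / (Real.pi ^ ((d : ℝ) / 2) * Real.Gamma (β + 1))) *
              (1 - ‖X i‖ ^ 2) ^ β
           else 0)
    = (Real.Gamma (β + (d : ℝ) / 2 + 1) / Real.Gamma (β + ((d : ℝ) + κ) / 2 + 1)) ^ d *
        ∏ i ∈ Finset.Icc 1 d,
          Real.Gamma (((d : ℝ) + κ - (i : ℝ) + 1) / 2) / Real.Gamma (((d : ℝ) - (i : ℝ) + 1) / 2) := by
  change ∫ X : Fin d → EuclideanSpace ℝ (Fin d),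
    parallelotopeVolume X ^ κ * ∏ i, betaBallPDFReal d β (X i) = _
  have hvol : Measurable fun X : Fin d → EuclideanSpace ℝ (Fin d) => parallelotopeVolume X ^ κ :=
    (continuous_parallelotopeVolume d).measurable.pow_const κ
  have hnonneg : ∀ X : Fin d → EuclideanSpace ℝ (Fin d), 0 ≤ parallelotopeVolume X ^ κ :=
    fun X => Real.rpow_nonneg (parallelotopeVolume_nonneg X) κ
  have hpdf := betaBallPDFReal_nonneg d hβ
  have hprod : ∏ i ∈ Finset.Icc 1 d,
      Real.Gamma (((d : ℝ) + κ - (i : ℝ) + 1) / 2) / Real.Gamma (((d : ℝ) - (i : ℝ) + 1) / 2) =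
      ∏ i : Fin d, Real.Gamma (((d : ℝ) - (i : ℕ) + κ) / 2) /
        Real.Gamma (((d : ℝ) - (i : ℕ)) / 2) := by
    rw [Fin.prod_univ_eq_prod_range (fun i : ℕ => Real.Gamma (((d : ℝ) - i + κ) / 2) /
      Real.Gamma (((d : ℝ) - i) / 2)) d, ← Finset.Ico_add_one_right_eq_Icc,
      Finset.prod_Ico_eq_prod_range, Nat.add_sub_cancel]
    refine Finset.prod_congr rfl fun i _ => ?_
    push_cast
    ring_nf
  rw [integral_eq_lintegral_of_nonneg_ae
    (.of_forall fun X => mul_nonneg (hnonneg X) (Finset.prod_nonneg fun i _ => hpdf (X i)))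
    (by fun_prop), hprod]
  have hsplit : ∀ X : Fin d → EuclideanSpace ℝ (Fin d),
      ENNReal.ofReal (parallelotopeVolume X ^ κ * ∏ i, betaBallPDFReal d β (X i)) =
      ENNReal.ofReal (parallelotopeVolume X ^ κ) *
        ∏ i, ENNReal.ofReal (betaBallPDFReal d β (X i)) := fun X => by
    rw [ENNReal.ofReal_mul (hnonneg X), ENNReal.ofReal_prod_of_nonneg fun i _ => hpdf (X i)]
  simp_rw [hsplit]
  rw [volume_pi, ← lintegral_pi_withDensity volume
    (f := fun x => ENNReal.ofReal (betaBallPDFReal d β x)) (by fun_prop) d hvol.ennreal_ofReal]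
  refine (congrArg ENNReal.toReal (lintegral_parallelotopeVolume_rpow hκ d hβ)).trans
    (ENNReal.toReal_ofReal ?_)
  have hd0 : (1 : ℝ) ≤ d := Nat.one_le_cast.2 hd
  have h1 := Real.Gamma_pos_of_pos (show 0 < β + (d : ℝ) / 2 + 1 by linarith)
  have h2 := Real.Gamma_pos_of_pos (show 0 < β + ((d : ℝ) + κ) / 2 + 1 by linarith)
  refine mul_nonneg (by positivity) (Finset.prod_nonneg fun i _ => ?_)
  have hi : ((i : ℕ) : ℝ) < d := Nat.cast_lt.2 i.isLt
  exact div_nonneg (Real.Gamma_nonneg_of_nonneg (by linarith))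
    (Real.Gamma_nonneg_of_nonneg (by linarith))
end

section
/- Let X_1,...,X_d be i.i.d. random points in ℝ^d, each distributed according to the beta' density f̃_{d,β} with β > d/2, and let ∇_d denote the volume of the parallelotope spanned by X_1,...,X_d. Then for every κ with 0 ≤ κ < 2β-d, E[∇_d^κ] = (Γ(β-(d+κ)/2)/Γ(β-d/2))^d · ∏_{i=1}^d Γ((d+κ-i+1)/2)/Γ((d-i+1)/2). -/
open MeasureTheory

section
open ProbabilityTheory Module
open scoped ENNReal

theorem lintegral_pi_fin_succ {n : ℕ} {E : Type*} [MeasurableSpace E]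
    (μ : Fin (n + 1) → Measure E) [∀ i, SigmaFinite (μ i)] {F : (Fin (n + 1) → E) → ℝ≥0∞}
    (hF : Measurable F) :
    ∫⁻ X, F X ∂(Measure.pi μ) =
      ∫⁻ x, ∫⁻ Y, F (Fin.cons x Y) ∂(Measure.pi fun i => μ (Fin.succ i)) ∂(μ 0) := by
  have h := (measurePreserving_piFinSuccAbove μ 0).symm
  rw [← h.lintegral_comp hF]
  refine (lintegral_prod _ (hF.comp h.measurable).aemeasurable).trans ?_
  simp [MeasurableEquiv.piFinSuccAbove, Fin.insertNthEquiv]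

theorem lintegral_pi_fin_prod {E : Type*} [MeasurableSpace E] :
    ∀ {n : ℕ} (μ : Fin n → Measure E) [∀ i, SigmaFinite (μ i)] {f : Fin n → E → ℝ≥0∞}
      (_ : ∀ i, Measurable (f i)),
      ∫⁻ X, ∏ i, f i (X i) ∂(Measure.pi μ) = ∏ i, ∫⁻ x, f i x ∂(μ i)
  | 0, μ, _, f, _ => by simp [lintegral_unique]
  | n + 1, μ, _, f, hf => by
    rw [lintegral_pi_fin_succ μ (by fun_prop), Fin.prod_univ_succ,
      ← lintegral_pi_fin_prod (fun i => μ (Fin.succ i)) fun i => hf (Fin.succ i),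
      ← lintegral_mul_const _ (hf 0)]
    refine lintegral_congr fun x => ?_
    simp only [Fin.prod_univ_succ, Fin.cons_zero, Fin.cons_succ]
    rw [lintegral_const_mul _ (by fun_prop)]

theorem pi_fin_withDensity {n : ℕ} {E : Type*} [MeasurableSpace E] (μ : Measure E) [SigmaFinite μ]
    {f : E → ℝ≥0∞} (hf : Measurable f) [SigmaFinite (μ.withDensity f)] :
    (Measure.pi fun _ : Fin n => μ.withDensity f) =
      (Measure.pi fun _ => μ).withDensity fun X => ∏ i, f (X i) := by
  refine Measure.pi_eq fun s hs => ?_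
  rw [withDensity_apply _ (MeasurableSet.univ_pi hs), Measure.restrict_pi_pi,
    lintegral_pi_fin_prod _ fun _ => hf]
  exact Finset.prod_congr rfl fun i _ => (withDensity_apply _ (hs i)).symm

/-- Measures which agree, up to a constant, on homogeneous functions of degree `κ` have powers
which agree, up to a constant, on functions that are homogeneous of degree `κ` in each variable. -/
theorem lintegral_pi_eq_of_homogeneous {E : Type*} [AddCommGroup E] [Module ℝ E]
    [MeasurableSpace E] (μ ν : Measure E) [SigmaFinite μ] [SigmaFinite ν] (κ : ℝ) (C : ℝ≥0∞)
    (h : ∀ F : E → ℝ≥0∞, Measurable F →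
      (∀ (r : ℝ) (x : E), 0 < r → F (r • x) = ENNReal.ofReal (r ^ κ) * F x) →
      ∫⁻ x, F x ∂μ = C * ∫⁻ x, F x ∂ν) :
    ∀ (n : ℕ) (F : (Fin n → E) → ℝ≥0∞), Measurable F →
      (∀ (i : Fin n) (r : ℝ) (X : Fin n → E), 0 < r →
        F (Function.update X i (r • X i)) = ENNReal.ofReal (r ^ κ) * F X) →
      ∫⁻ X, F X ∂(Measure.pi fun _ => μ) = C ^ n * ∫⁻ X, F X ∂(Measure.pi fun _ => ν) := by
  intro n
  induction n with
  | zero => intro F _ _; simp [lintegral_unique]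
  | succ n ih =>
    intro F hF hom
    have hcons : Measurable fun p : E × (Fin n → E) => F (Fin.cons p.1 p.2) := by
      have h0 : Measurable fun p : E × (Fin n → E) =>
          (Fin.cons p.1 p.2 : Fin (n + 1) → E) := by
        refine measurable_pi_lambda _ fun i => ?_
        refine Fin.cases ?_ (fun j => ?_) i
        · simpa using measurable_fst
        · simp only [Fin.cons_succ]; fun_prop
      exact hF.comp h0
    rw [lintegral_pi_fin_succ _ hF, lintegral_pi_fin_succ _ hF]
    have h1 : ∀ x, ∫⁻ Y, F (Fin.cons x Y) ∂(Measure.pi fun _ : Fin n => μ) =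
        C ^ n * ∫⁻ Y, F (Fin.cons x Y) ∂(Measure.pi fun _ : Fin n => ν) := by
      intro x
      refine ih _ (hcons.comp measurable_prodMk_left) fun i r X hr => ?_
      have := hom i.succ r (Fin.cons x X) hr
      simpa [Fin.cons_update] using this
    have hm : Measurable fun x => ∫⁻ Y, F (Fin.cons x Y) ∂(Measure.pi fun _ : Fin n => ν) :=
      hcons.lintegral_prod_right'
    simp_rw [h1]
    rw [lintegral_const_mul _ hm, h _ hm, pow_succ, mul_assoc]
    intro r x hr
    refine Eq.trans ?_ (lintegral_const_mul _ (hcons.comp measurable_prodMk_left))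
    refine lintegral_congr fun Y => ?_
    simpa using hom 0 r (Fin.cons x Y) hr

theorem stdGaussian_euclideanSpace_eq_withDensity (n : ℕ) :
    stdGaussian (EuclideanSpace ℝ (Fin n)) =
      volume.withDensity fun x =>
        ENNReal.ofReal ((2 * Real.pi) ^ (-(n : ℝ) / 2) * Real.exp (-‖x‖ ^ 2 / 2)) := by
  have hvol := PiLp.volume_preserving_toLp (Fin n)
  have hg : gaussianReal 0 1 = volume.withDensity (gaussianPDF 0 1) :=
    gaussianReal_of_var_ne_zero 0 one_ne_zero
  have : SigmaFinite ((volume : Measure ℝ).withDensity (gaussianPDF 0 1)) := by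
    rw [← hg]; infer_instance
  rw [← map_pi_eq_stdGaussian, hg, pi_fin_withDensity _ (measurable_gaussianPDF 0 1),
    ← volume_pi]
  ext s hs
  rw [Measure.map_apply (by fun_prop) hs, withDensity_apply _ hs,
    withDensity_apply _ (hs.preimage (by fun_prop)),
    ← hvol.setLIntegral_comp_preimage hs (by fun_prop)]
  refine lintegral_congr fun x => ?_
  simp only [gaussianPDF, gaussianPDFReal]
  rw [← ENNReal.ofReal_prod_of_nonneg (fun i _ => by positivity), Finset.prod_mul_distrib,
    ← Real.exp_sum, EuclideanSpace.real_norm_sq_eq]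
  congr 2
  · rw [Finset.prod_const, Finset.card_univ, Fintype.card_fin, Real.sqrt_eq_rpow,
      ← Real.rpow_neg (by positivity), ← Real.rpow_mul_natCast (by positivity)]
    congr 1
    · simp
    · ring
  · congr 1
    simp [neg_div, Finset.sum_div]

theorem map_tail_stdGaussian (n : ℕ) :
    (stdGaussian (EuclideanSpace ℝ (Fin (n + 1)))).map
        (fun x => WithLp.toLp 2 (fun i : Fin n => x i.succ)) =
      stdGaussian (EuclideanSpace ℝ (Fin n)) := by
  rw [← map_pi_eq_stdGaussian, ← map_pi_eq_stdGaussian, Measure.map_map (by fun_prop) (by fun_prop)]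
  have h := measurePreserving_piFinSuccAbove (fun _ : Fin (n + 1) => gaussianReal 0 1) 0
  have h2 := (measurePreserving_snd (μ := gaussianReal 0 1)
    (ν := Measure.pi fun _ : Fin n => gaussianReal 0 1)).comp h
  rw [← h2.map_eq, Measure.map_map (by fun_prop) h2.measurable]
  rfl

theorem integral_norm_rpow_mul_exp {n : ℕ} (hn : 1 ≤ n) {κ : ℝ} (hκ : 0 ≤ κ) :
    ∫ x : EuclideanSpace ℝ (Fin n), (2 * Real.pi) ^ (-(n : ℝ) / 2) * Real.exp (-‖x‖ ^ 2 / 2) *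
        ‖x‖ ^ κ =
      2 ^ (κ / 2) * Real.Gamma ((n + κ) / 2) / Real.Gamma (n / 2) := by
  have hn' : (0 : ℝ) < n := by exact_mod_cast hn
  have : Nonempty (Fin n) := ⟨⟨0, hn⟩⟩
  have hΓ : Real.Gamma ((n : ℝ) / 2) ≠ 0 := (Real.Gamma_pos_of_pos (by positivity)).ne'
  have key : ∫ y in Set.Ioi (0 : ℝ), y ^ (n - 1) •
      ((2 * Real.pi) ^ (-(n : ℝ) / 2) * Real.exp (-y ^ 2 / 2) * y ^ κ) =
      (2 * Real.pi) ^ (-(n : ℝ) / 2) *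
        ((1 / 2) ^ (-(n - 1 + κ + 1) / 2) * (1 / 2) * Real.Gamma ((n - 1 + κ + 1) / 2)) := by
    rw [← integral_rpow_mul_exp_neg_mul_rpow (by norm_num) (by linarith) (by norm_num),
      ← integral_const_mul]
    refine setIntegral_congr_fun measurableSet_Ioi fun y hy => ?_
    have hy : 0 < y := hy
    simp only [smul_eq_mul]
    rw [Real.rpow_add hy, ← Nat.cast_pred hn, Real.rpow_natCast, Real.rpow_two,
      show -(1 / 2) * y ^ 2 = -y ^ 2 / 2 by ring]
    ring
  rw [integral_fun_norm_addHaar volume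
    (fun y => (2 * Real.pi) ^ (-(n : ℝ) / 2) * Real.exp (-y ^ 2 / 2) * y ^ κ),
    finrank_euclideanSpace, Fintype.card_fin, key, Measure.real, EuclideanSpace.volume_ball]
  simp only [ENNReal.ofReal_one, one_pow, one_mul, Fintype.card_fin, nsmul_eq_mul, smul_eq_mul]
  rw [ENNReal.toReal_ofReal (by positivity), Real.Gamma_add_one (by positivity),
    Real.mul_rpow (by norm_num) (by positivity), Real.sqrt_eq_rpow, ← Real.rpow_mul_natCast
    (by positivity), one_div (2 : ℝ), Real.inv_rpow (by norm_num), ← Real.rpow_neg (by norm_num),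
    show (n : ℝ) - 1 + κ + 1 = n + κ by ring,
    show -(-((n : ℝ) + κ) / 2) = n / 2 + κ / 2 by ring, Real.rpow_add (by norm_num),
    show -(n : ℝ) / 2 = -(n / 2) by ring, show (2 : ℝ)⁻¹ * n = n / 2 by ring,
    Real.rpow_neg (by norm_num), Real.rpow_neg (by positivity)]
  have h1 : (2 : ℝ) ^ ((n : ℝ) / 2) ≠ 0 := by positivity
  have h2 : Real.pi ^ ((n : ℝ) / 2) ≠ 0 := by positivity
  field_simp

theorem lintegral_norm_rpow_stdGaussian {n : ℕ} (hn : 1 ≤ n) {κ : ℝ} (hκ : 0 ≤ κ) :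
    ∫⁻ x, ENNReal.ofReal (‖x‖ ^ κ) ∂(stdGaussian (EuclideanSpace ℝ (Fin n))) =
      ENNReal.ofReal (2 ^ (κ / 2) * Real.Gamma ((n + κ) / 2) / Real.Gamma (n / 2)) := by
  have hn' : (0 : ℝ) < n := by exact_mod_cast hn
  rw [stdGaussian_euclideanSpace_eq_withDensity,
    lintegral_withDensity_eq_lintegral_mul _ (by fun_prop) (by fun_prop),
    ← integral_norm_rpow_mul_exp hn hκ, ofReal_integral_eq_lintegral_ofReal]
  · refine lintegral_congr fun x => ?_
    rw [Pi.mul_apply, ← ENNReal.ofReal_mul (by positivity)]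
  · refine Integrable.of_integral_ne_zero ?_
    rw [integral_norm_rpow_mul_exp hn hκ]
    have := Real.Gamma_pos_of_pos (show 0 < ((n : ℝ) + κ) / 2 by positivity)
    have := Real.Gamma_pos_of_pos (show 0 < (n : ℝ) / 2 by positivity)
    positivity
  · exact ae_of_all _ fun x => by positivity

theorem measurable_det_euclideanSpace (n : ℕ) :
    Measurable fun X : Fin n → EuclideanSpace ℝ (Fin n) =>
      (Matrix.of fun i j : Fin n => X j i).det := by
  simp only [Matrix.det_apply, Matrix.of_apply]
  fun_prop

theorem abs_det_comp_linearIsometryEquiv {n : ℕ}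
    (U : EuclideanSpace ℝ (Fin n) ≃ₗᵢ[ℝ] EuclideanSpace ℝ (Fin n))
    (X : Fin n → EuclideanSpace ℝ (Fin n)) :
    |(Matrix.of fun i j : Fin n => U (X j) i).det| = |(Matrix.of fun i j : Fin n => X j i).det| := by
  have h := (EuclideanSpace.basisFun (Fin n) ℝ).toBasis.det_comp U.toLinearEquiv.toLinearMap X
  have hU : |LinearMap.det U.toLinearEquiv.toLinearMap| = 1 := by
    rw [← LinearMap.normDet_eq_abs_det]
    exact U.toLinearIsometry.normDet_eq_one
  have h2 := congrArg abs h
  rw [abs_mul, hU, one_mul, Basis.det_apply, Basis.det_apply] at h2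
  exact h2

theorem det_of_cons_single {n : ℕ} (a : ℝ) (Y : Fin n → EuclideanSpace ℝ (Fin (n + 1))) :
    (Matrix.of fun i j : Fin (n + 1) =>
        (Fin.cons (EuclideanSpace.single 0 a) Y : Fin (n + 1) → EuclideanSpace ℝ (Fin (n + 1))) j
          i).det =
      a * (Matrix.of fun i j : Fin n => Y j i.succ).det := by
  rw [Matrix.det_succ_column_zero, Fin.sum_univ_succ]
  simp [Matrix.submatrix, Fin.succ_ne_zero]

theorem lintegral_abs_det_cons_stdGaussian {n : ℕ} (κ : ℝ) (v : EuclideanSpace ℝ (Fin (n + 1))) :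
    ∫⁻ Y : Fin n → EuclideanSpace ℝ (Fin (n + 1)),
        ENNReal.ofReal (|(Matrix.of fun i j : Fin (n + 1) =>
          (Fin.cons v Y : Fin (n + 1) → EuclideanSpace ℝ (Fin (n + 1))) j i).det| ^ κ)
        ∂(Measure.pi fun _ => stdGaussian (EuclideanSpace ℝ (Fin (n + 1)))) =
      ENNReal.ofReal (‖v‖ ^ κ) * ∫⁻ Z : Fin n → EuclideanSpace ℝ (Fin n),
        ENNReal.ofReal (|(Matrix.of fun i j : Fin n => Z j i).det| ^ κ)
        ∂(Measure.pi fun _ => stdGaussian (EuclideanSpace ℝ (Fin n))) := by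
  obtain ⟨U, hU⟩ : ∃ U : EuclideanSpace ℝ (Fin (n + 1)) ≃ₗᵢ[ℝ] EuclideanSpace ℝ (Fin (n + 1)),
      U v = EuclideanSpace.single 0 ‖v‖ :=
    ⟨_, Submodule.reflection_sub (by simp)⟩
  let T : EuclideanSpace ℝ (Fin (n + 1)) → EuclideanSpace ℝ (Fin n) :=
    fun x => WithLp.toLp 2 fun i => x i.succ
  have hT : Measurable T := by fun_prop
  have hTU : (stdGaussian (EuclideanSpace ℝ (Fin (n + 1)))).map (fun x => T (U x)) =
      stdGaussian (EuclideanSpace ℝ (Fin n)) := by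
    have h := Measure.map_map (μ := stdGaussian (EuclideanSpace ℝ (Fin (n + 1)))) hT
      U.continuous.measurable
    rw [stdGaussian_map U, map_tail_stdGaussian] at h
    exact h.symm
  have hmp := measurePreserving_pi
    (fun _ : Fin n => stdGaussian (EuclideanSpace ℝ (Fin (n + 1))))
    (fun _ : Fin n => stdGaussian (EuclideanSpace ℝ (Fin n)))
    fun _ => ⟨hT.comp U.continuous.measurable, hTU⟩
  have hm : Measurable fun Z : Fin n → EuclideanSpace ℝ (Fin n) =>
      ENNReal.ofReal (|(Matrix.of fun i j : Fin n => Z j i).det| ^ κ) := by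
    have := measurable_det_euclideanSpace n
    simp only [← Real.norm_eq_abs]
    fun_prop
  rw [← hmp.lintegral_comp hm]
  refine Eq.trans ?_ (lintegral_const_mul _ (hm.comp hmp.measurable))
  refine lintegral_congr fun Y => ?_
  simp only [Function.comp_apply]
  rw [← ENNReal.ofReal_mul (by positivity), ← Real.mul_rpow (by positivity) (by positivity),
    ← abs_det_comp_linearIsometryEquiv U]
  have hc : (fun j => U ((Fin.cons v Y : Fin (n + 1) → EuclideanSpace ℝ (Fin (n + 1))) j)) =
      Fin.cons (EuclideanSpace.single 0 ‖v‖) fun j => U (Y j) := by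
    funext j
    refine Fin.cases ?_ (fun j => ?_) j
    · simp [hU]
    · simp
  have hd := det_of_cons_single ‖v‖ fun j => U (Y j)
  rw [← hc] at hd
  rw [hd, abs_mul, abs_norm]

theorem lintegral_abs_det_rpow_stdGaussian {κ : ℝ} (hκ : 0 ≤ κ) (n : ℕ) :
    ∫⁻ X : Fin n → EuclideanSpace ℝ (Fin n),
        ENNReal.ofReal (|(Matrix.of fun i j : Fin n => X j i).det| ^ κ)
        ∂(Measure.pi fun _ => stdGaussian (EuclideanSpace ℝ (Fin n))) =
      ∏ m ∈ Finset.range n, ENNReal.ofReal (2 ^ (κ / 2) * Real.Gamma (((m + 1 : ℕ) + κ) / 2) /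
        Real.Gamma ((m + 1 : ℕ) / 2)) := by
  induction n with
  | zero => simp
  | succ n ih =>
    rw [lintegral_pi_fin_succ, Finset.prod_range_succ, ← ih,
      ← lintegral_norm_rpow_stdGaussian (by lia) hκ, mul_comm,
      ← lintegral_mul_const _ (by fun_prop)]
    · exact lintegral_congr fun v => lintegral_abs_det_cons_stdGaussian κ v
    · have := measurable_det_euclideanSpace (n + 1)
      simp only [← Real.norm_eq_abs]
      fun_prop

theorem lintegral_rpow_mul_exp_neg_mul_Ioi {a r : ℝ} (ha : 0 < a) (hr : 0 < r) :
    ∫⁻ t in Set.Ioi (0 : ℝ), ENNReal.ofReal (t ^ (a - 1) * Real.exp (-(r * t))) =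
      ENNReal.ofReal (r ^ (-a) * Real.Gamma a) := by
  have h := Real.integral_rpow_mul_exp_neg_mul_Ioi ha hr
  rw [one_div, Real.inv_rpow hr.le, ← Real.rpow_neg hr.le] at h
  rw [← h, ofReal_integral_eq_lintegral_ofReal]
  · refine Integrable.of_integral_ne_zero ?_
    rw [h]
    have := Real.Gamma_pos_of_pos ha
    positivity
  · refine (ae_restrict_mem measurableSet_Ioi).mono fun t ht => ?_
    have : 0 < t := ht
    positivity

theorem lintegral_homogeneous_mul_exp {n : ℕ} {κ t : ℝ} (ht : 0 < t)
    {F : EuclideanSpace ℝ (Fin n) → ℝ≥0∞} (hF : Measurable F)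
    (hom : ∀ (r : ℝ) (x : EuclideanSpace ℝ (Fin n)), 0 < r →
      F (r • x) = ENNReal.ofReal (r ^ κ) * F x) :
    ∫⁻ x, F x * ENNReal.ofReal (Real.exp (-(t * ‖x‖ ^ 2))) =
      ENNReal.ofReal (2 ^ (-κ / 2) * Real.pi ^ ((n : ℝ) / 2) * t ^ (-((n : ℝ) + κ) / 2)) *
        ∫⁻ x, F x ∂(stdGaussian (EuclideanSpace ℝ (Fin n))) := by
  set r : ℝ := (2 * t) ^ (-(1 / 2) : ℝ) with hr_def
  have hr : 0 < r := by positivity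
  have hr2 : t * r ^ 2 = 1 / 2 := by
    rw [hr_def, ← Real.rpow_mul_natCast (by positivity)]
    norm_num
    rw [Real.rpow_neg_one]
    field_simp
  have hmap := Measure.map_addHaar_smul (volume : Measure (EuclideanSpace ℝ (Fin n))) hr.ne'
  have hG : Measurable fun x => F x * ENNReal.ofReal (Real.exp (-(t * ‖x‖ ^ 2))) := by fun_prop
  have h := lintegral_map (μ := volume) hG (measurable_const_smul r)
  rw [hmap, lintegral_smul_measure, finrank_euclideanSpace, Fintype.card_fin, smul_eq_mul,
    abs_of_pos (by positivity)] at h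
  have h2 : ∫⁻ x, F x * ENNReal.ofReal (Real.exp (-(t * ‖x‖ ^ 2))) =
      ENNReal.ofReal (r ^ n) *
        ∫⁻ x, F (r • x) * ENNReal.ofReal (Real.exp (-(t * ‖r • x‖ ^ 2))) := by
    rw [← h, ← mul_assoc, ← ENNReal.ofReal_mul (by positivity), mul_inv_cancel₀ (by positivity),
      ENNReal.ofReal_one, one_mul]
  rw [h2, stdGaussian_euclideanSpace_eq_withDensity,
    lintegral_withDensity_eq_lintegral_mul _ (by fun_prop) hF,
    ← lintegral_const_mul _ (by fun_prop), ← lintegral_const_mul _ (by fun_prop)]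
  refine lintegral_congr fun x => ?_
  rw [hom r x hr, norm_smul, Real.norm_of_nonneg hr.le, mul_pow, ← mul_assoc t, hr2, Pi.mul_apply]
  have hc : r ^ n * r ^ κ = 2 ^ (-κ / 2) * Real.pi ^ ((n : ℝ) / 2) * t ^ (-((n : ℝ) + κ) / 2) *
      (2 * Real.pi) ^ (-(n : ℝ) / 2) := by
    rw [← Real.rpow_natCast, ← Real.rpow_add hr, hr_def, ← Real.rpow_mul (by positivity),
      Real.mul_rpow (by norm_num) ht.le, Real.mul_rpow (by norm_num) (by positivity),
      show -(1 / 2) * ((n : ℝ) + κ) = -κ / 2 + -n / 2 by ring, Real.rpow_add (by norm_num),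
      show -((n : ℝ) + κ) / 2 = -κ / 2 + -n / 2 by ring,
      show -(n : ℝ) / 2 = -(n / 2) by ring, Real.rpow_neg Real.pi_pos.le]
    have h2 : Real.pi ^ ((n : ℝ) / 2) ≠ 0 := by positivity
    field_simp
  calc _ = F x * ENNReal.ofReal (r ^ n * r ^ κ * Real.exp (-‖x‖ ^ 2 / 2)) := by
        rw [ENNReal.ofReal_mul (by positivity), ENNReal.ofReal_mul (by positivity),
          show -(1 / 2 * ‖x‖ ^ 2) = -‖x‖ ^ 2 / 2 by ring]
        ring
    _ = _ := by
        rw [hc, mul_assoc, ENNReal.ofReal_mul (by positivity)]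
        ring

theorem lintegral_homogeneous_mul_betaPrime {n : ℕ} {β κ : ℝ} (hκ0 : 0 ≤ κ)
    (hκ : κ < 2 * β - n) {F : EuclideanSpace ℝ (Fin n) → ℝ≥0∞} (hF : Measurable F)
    (hom : ∀ (r : ℝ) (x : EuclideanSpace ℝ (Fin n)), 0 < r →
      F (r • x) = ENNReal.ofReal (r ^ κ) * F x) :
    ∫⁻ x, F x * ENNReal.ofReal ((1 + ‖x‖ ^ 2) ^ (-β)) =
      ENNReal.ofReal (2 ^ (-κ / 2) * Real.pi ^ ((n : ℝ) / 2) *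
          Real.Gamma (β - ((n : ℝ) + κ) / 2) / Real.Gamma β) *
        ∫⁻ x, F x ∂(stdGaussian (EuclideanSpace ℝ (Fin n))) := by
  have hn : (0 : ℝ) ≤ n := n.cast_nonneg
  have hβ : 0 < β := by linarith
  have hΓ := Real.Gamma_pos_of_pos hβ
  have hs : 0 < β - ((n : ℝ) + κ) / 2 := by linarith
  have key : ENNReal.ofReal (Real.Gamma β) * ∫⁻ x, F x * ENNReal.ofReal ((1 + ‖x‖ ^ 2) ^ (-β)) =
      ENNReal.ofReal (2 ^ (-κ / 2) * Real.pi ^ ((n : ℝ) / 2) *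
          Real.Gamma (β - ((n : ℝ) + κ) / 2)) *
        ∫⁻ x, F x ∂(stdGaussian (EuclideanSpace ℝ (Fin n))) := by
    calc _ = ∫⁻ x, ∫⁻ t in Set.Ioi (0 : ℝ), F x *
          ENNReal.ofReal (t ^ (β - 1) * Real.exp (-((1 + ‖x‖ ^ 2) * t))) := by
          rw [← lintegral_const_mul _ (by fun_prop)]
          refine lintegral_congr fun x => ?_
          rw [lintegral_const_mul _ (by fun_prop),
            lintegral_rpow_mul_exp_neg_mul_Ioi hβ (by positivity),
            ENNReal.ofReal_mul (by positivity)]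
          ring
      _ = ∫⁻ t in Set.Ioi (0 : ℝ), ∫⁻ x, F x *
          ENNReal.ofReal (t ^ (β - 1) * Real.exp (-((1 + ‖x‖ ^ 2) * t))) :=
          lintegral_lintegral_swap (by fun_prop)
      _ = ∫⁻ t in Set.Ioi (0 : ℝ),
          ENNReal.ofReal (t ^ (β - ((n : ℝ) + κ) / 2 - 1) * Real.exp (-(1 * t))) *
          (ENNReal.ofReal (2 ^ (-κ / 2) * Real.pi ^ ((n : ℝ) / 2)) *
            ∫⁻ x, F x ∂(stdGaussian (EuclideanSpace ℝ (Fin n)))) := by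
          refine setLIntegral_congr_fun measurableSet_Ioi fun t ht => ?_
          have ht : 0 < t := ht
          have h1 : ∀ x : EuclideanSpace ℝ (Fin n), F x *
              ENNReal.ofReal (t ^ (β - 1) * Real.exp (-((1 + ‖x‖ ^ 2) * t))) =
              ENNReal.ofReal (t ^ (β - 1) * Real.exp (-(1 * t))) *
                (F x * ENNReal.ofReal (Real.exp (-(t * ‖x‖ ^ 2)))) := fun x => by
            rw [show -((1 + ‖x‖ ^ 2) * t) = -(1 * t) + -(t * ‖x‖ ^ 2) by ring, Real.exp_add,
              ← mul_assoc, ENNReal.ofReal_mul (by positivity)]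
            ring
          simp only [h1]
          rw [lintegral_const_mul _ (by fun_prop), lintegral_homogeneous_mul_exp ht hF hom,
            ← mul_assoc, ← mul_assoc, ← ENNReal.ofReal_mul (by positivity),
            ← ENNReal.ofReal_mul (by positivity),
            show β - ((n : ℝ) + κ) / 2 - 1 = (β - 1) + (-((n : ℝ) + κ) / 2) by ring,
            Real.rpow_add ht]
          ring_nf
      _ = _ := by
          rw [lintegral_mul_const _ (by fun_prop), lintegral_rpow_mul_exp_neg_mul_Ioi hs one_pos,
            ← mul_assoc, ← ENNReal.ofReal_mul (by have := Real.Gamma_pos_of_pos hs; positivity),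
            Real.one_rpow]
          ring_nf
  have h0 : ENNReal.ofReal (Real.Gamma β) ≠ 0 := by simpa using hΓ
  rw [← ENNReal.mul_right_inj h0 ENNReal.ofReal_ne_top, key, ← mul_assoc,
    ← ENNReal.ofReal_mul hΓ.le, mul_div_cancel₀ _ hΓ.ne']

theorem homogeneous_abs_det_rpow {n : ℕ} (κ : ℝ) (i : Fin n) {r : ℝ}
    (X : Fin n → EuclideanSpace ℝ (Fin n)) (hr : 0 < r) :
    ENNReal.ofReal (|(Matrix.of fun k j : Fin n =>
        Function.update X i (r • X i) j k).det| ^ κ) =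
      ENNReal.ofReal (r ^ κ) *
        ENNReal.ofReal (|(Matrix.of fun k j : Fin n => X j k).det| ^ κ) := by
  have h : (Matrix.of fun k j : Fin n => Function.update X i (r • X i) j k) =
      (Matrix.of fun k j : Fin n => X j k).updateCol i (r • fun k => X i k) := by
    ext k j
    rcases eq_or_ne j i with rfl | hj
    · simp
    · simp [hj]
  have h' : (Matrix.of fun k j : Fin n => X j k).updateCol i (fun k => X i k) =
      Matrix.of fun k j : Fin n => X j k := by
    ext k j
    rcases eq_or_ne j i with rfl | hj
    · simp
    · simp [hj]
  rw [h, Matrix.det_updateCol_smul, h', abs_mul, abs_of_pos hr,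
    Real.mul_rpow hr.le (abs_nonneg _), ENNReal.ofReal_mul (by positivity)]

theorem prod_Icc_one_eq_prod_range_reflect {M : Type*} [CommMonoid M] (d : ℕ) (f g : ℕ → M)
    (h : ∀ m < d, f (d - m) = g m) : ∏ i ∈ Finset.Icc 1 d, f i = ∏ m ∈ Finset.range d, g m := by
  refine Finset.prod_nbij' (fun i => d - i) (fun m => d - m) ?_ ?_ ?_ ?_ ?_
  · intro i hi
    simp only [Finset.mem_Icc, Finset.mem_range] at *
    lia
  · intro m hm
    simp only [Finset.mem_Icc, Finset.mem_range] at *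
    lia
  · intro i hi
    simp only [Finset.mem_Icc] at *
    lia
  · intro m hm
    simp only [Finset.mem_range] at *
    lia
  · intro i hi
    simp only [Finset.mem_Icc] at hi
    rw [← h (d - i) (by lia), Nat.sub_sub_self hi.2]

end

/-- Mathai's formula: moments of the volume of the random parallelotope spanned by `d`
i.i.d. beta'-distributed points in `ℝ^d`. -/
theorem betaPrime_parallelotope_moments (d : ℕ) (hd : 1 ≤ d) (β : ℝ) (hβ : (d : ℝ) / 2 < β)
    (κ : ℝ) (hκ0 : 0 ≤ κ) (hκ : κ < 2 * β - d) :
    ∫ X : Fin d → EuclideanSpace ℝ (Fin d),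
      |(Matrix.of fun i j : Fin d => X j i).det| ^ κ *
        ∏ i : Fin d,
          ((Real.Gamma β / (Real.pi ^ ((d : ℝ) / 2) * Real.Gamma (β - (d : ℝ) / 2))) *
            (1 + ‖X i‖ ^ 2) ^ (-β))
    = (Real.Gamma (β - ((d : ℝ) + κ) / 2) / Real.Gamma (β - (d : ℝ) / 2)) ^ d *
        ∏ i ∈ Finset.Icc 1 d,
          Real.Gamma (((d : ℝ) + κ - (i : ℝ) + 1) / 2) / Real.Gamma (((d : ℝ) - (i : ℝ) + 1) / 2) := by
  have hd' : (0 : ℝ) ≤ d := d.cast_nonneg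
  have hΓβ := Real.Gamma_pos_of_pos (show 0 < β by linarith)
  have hΓβd := Real.Gamma_pos_of_pos (show 0 < β - (d : ℝ) / 2 by linarith)
  have hΓβκ := Real.Gamma_pos_of_pos (show 0 < β - ((d : ℝ) + κ) / 2 by linarith)
  set c := Real.Gamma β / (Real.pi ^ ((d : ℝ) / 2) * Real.Gamma (β - (d : ℝ) / 2)) with hc
  have hc0 : 0 < c := by positivity
  set f : EuclideanSpace ℝ (Fin d) → ℝ := fun x => c * (1 + ‖x‖ ^ 2) ^ (-β) with hf
  have hf0 : ∀ x, 0 ≤ f x := fun x => by positivity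
  have hfm : Measurable fun x => ENNReal.ofReal (f x) := by fun_prop
  have hdet : Measurable fun X : Fin d → EuclideanSpace ℝ (Fin d) =>
      |(Matrix.of fun i j : Fin d => X j i).det| ^ κ := by
    have := measurable_det_euclideanSpace d
    simp only [← Real.norm_eq_abs]
    fun_prop
  have hF : Measurable fun X : Fin d → EuclideanSpace ℝ (Fin d) =>
      ENNReal.ofReal (|(Matrix.of fun i j : Fin d => X j i).det| ^ κ) := hdet.ennreal_ofReal
  set C := 2 ^ (-κ / 2) * Real.Gamma (β - ((d : ℝ) + κ) / 2) / Real.Gamma (β - (d : ℝ) / 2) with hC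
  have hC0 : 0 < C := by positivity
  have hcomp := lintegral_pi_eq_of_homogeneous
    (volume.withDensity fun x : EuclideanSpace ℝ (Fin d) => ENNReal.ofReal (f x))
    (ProbabilityTheory.stdGaussian (EuclideanSpace ℝ (Fin d))) κ (ENNReal.ofReal C)
    (fun G hG hom => by
      have h1 : c * (2 ^ (-κ / 2) * Real.pi ^ ((d : ℝ) / 2) *
          Real.Gamma (β - ((d : ℝ) + κ) / 2) / Real.Gamma β) = C := by
        rw [hc, hC]
        have : Real.pi ^ ((d : ℝ) / 2) ≠ 0 := by positivity
        field_simp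
      rw [lintegral_withDensity_eq_lintegral_mul _ hfm hG, ← h1, ENNReal.ofReal_mul hc0.le,
        mul_assoc, ← lintegral_homogeneous_mul_betaPrime hκ0 hκ hG hom,
        ← lintegral_const_mul _ (by fun_prop)]
      refine lintegral_congr fun x => ?_
      rw [Pi.mul_apply, hf, ENNReal.ofReal_mul hc0.le]
      ring)
    d _ hF fun i r X hr => homogeneous_abs_det_rpow κ i X hr
  rw [pi_fin_withDensity _ hfm, lintegral_withDensity_eq_lintegral_mul _ (by fun_prop) hF,
    lintegral_abs_det_rpow_stdGaussian hκ0] at hcomp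
  have hpos : ∀ m : ℕ, 0 ≤ 2 ^ (κ / 2) * Real.Gamma (((m + 1 : ℕ) + κ) / 2) /
      Real.Gamma ((m + 1 : ℕ) / 2) := fun m => by
    have := Real.Gamma_pos_of_pos (show 0 < (((m + 1 : ℕ) : ℝ) + κ) / 2 by positivity)
    have := Real.Gamma_pos_of_pos (show 0 < ((m + 1 : ℕ) : ℝ) / 2 by positivity)
    positivity
  rw [integral_eq_lintegral_of_nonneg_ae
    (ae_of_all _ fun X => mul_nonneg (by positivity) (Finset.prod_nonneg fun i _ => hf0 _))
    (hdet.mul (by fun_prop)).aestronglyMeasurable]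
  have hl : ∫⁻ X : Fin d → EuclideanSpace ℝ (Fin d), ENNReal.ofReal
      (|(Matrix.of fun i j : Fin d => X j i).det| ^ κ * ∏ i, f (X i)) =
      ENNReal.ofReal (C ^ d * ∏ m ∈ Finset.range d,
        (2 ^ (κ / 2) * Real.Gamma (((m + 1 : ℕ) + κ) / 2) / Real.Gamma ((m + 1 : ℕ) / 2))) := by
    rw [ENNReal.ofReal_mul (by positivity), ENNReal.ofReal_pow hC0.le,
      ENNReal.ofReal_prod_of_nonneg fun m _ => hpos m, ← hcomp]
    refine lintegral_congr fun X => ?_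
    rw [Pi.mul_apply, mul_comm, ENNReal.ofReal_mul (Finset.prod_nonneg fun i _ => hf0 _),
      ENNReal.ofReal_prod_of_nonneg fun i _ => hf0 _]
  rw [hl, ENNReal.toReal_ofReal (mul_nonneg (by positivity) (Finset.prod_nonneg fun m _ => hpos m)),
    prod_Icc_one_eq_prod_range_reflect d _
      (fun m => Real.Gamma (((m + 1 : ℕ) + κ) / 2) / Real.Gamma ((m + 1 : ℕ) / 2))
      fun m hm => by
        rw [Nat.cast_sub hm.le]
        push_cast
        ring_nf]
  simp only [mul_div_assoc, Finset.prod_mul_distrib, Finset.prod_const, Finset.card_range]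
  rw [hC, ← mul_assoc, ← mul_pow, mul_div_assoc, mul_right_comm, ← Real.rpow_add two_pos,
    neg_div, neg_add_cancel, Real.rpow_zero, one_mul]
end

section
/- Let X_0,...,X_d be i.i.d. random points in ℝ^d, each distributed according to the beta density f_{d,β} on the unit ball with β > -1, and let Δ_d be the volume of the simplex with vertices X_0,...,X_d. Then for every κ ≥ 0, E[Δ_d^κ] = (d!)^{-κ} · Γ((d+1)(2β+d+κ)/2 + 1)/Γ((d+1)(2β+d)/2 + dκ/2 + 1) · (Γ(d/2+β+1)/Γ((d+κ)/2+β+1))^{d+1} · ∏_{i=1}^d Γ((i+κ)/2)/Γ(i/2). -/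
open MeasureTheory
open scoped ENNReal

/-- The unnormalized beta profile `(1 - t)₊ ^ β`, as a function of the squared radius `t`. -/
noncomputable def betaProfile (β t : ℝ) : ℝ≥0∞ :=
  ENNReal.ofReal (if t < 1 then (1 - t) ^ β else 0)

lemma measurable_betaProfile (β : ℝ) : Measurable (betaProfile β) := by
  unfold betaProfile
  refine ENNReal.measurable_ofReal.comp (Measurable.ite measurableSet_Iio ?_ measurable_const)
  fun_prop

lemma betaProfile_of_one_le {β t : ℝ} (ht : 1 ≤ t) : betaProfile β t = 0 := by
  simp [betaProfile, ht.not_gt]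

lemma betaProfile_scale (β : ℝ) {h : ℝ} (hh : h < 1) (t : ℝ) :
    betaProfile β (h + (1 - h) * t) = ENNReal.ofReal ((1 - h) ^ β) * betaProfile β t := by
  have h1 : 0 < 1 - h := by linarith
  have hiff : h + (1 - h) * t < 1 ↔ t < 1 := by
    constructor <;> intro H <;> nlinarith
  unfold betaProfile
  by_cases ht : t < 1
  · rw [if_pos (hiff.2 ht), if_pos ht, ← ENNReal.ofReal_mul (by positivity),
      ← Real.mul_rpow h1.le (by linarith)]
    ring_nf
  · rw [if_neg (mt hiff.1 ht), if_neg ht]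
    simp

lemma lintegral_comp_mul_right_of_pos (f : ℝ → ℝ≥0∞) {c : ℝ} (hc : 0 < c) :
    ∫⁻ t, f t = ENNReal.ofReal c * ∫⁻ u, f (c * u) := by
  have h := Real.smul_map_volume_mul_left hc.ne'
  have e : MeasurableEmbedding (fun u : ℝ => c * u) :=
    (Homeomorph.mulLeft₀ c hc.ne').measurableEmbedding
  rw [← e.lintegral_map]
  conv_lhs => rw [← h]
  rw [lintegral_smul_measure, abs_of_pos hc, smul_eq_mul]

lemma lintegral_even (f : ℝ → ℝ≥0∞) (hf : ∀ t, f (-t) = f t) :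
    ∫⁻ t, f t = 2 * ∫⁻ t in Set.Ioi 0, f t := by
  rw [← lintegral_add_compl f (measurableSet_Ioi (a := (0 : ℝ))), Set.compl_Ioi,
    setLIntegral_congr Iio_ae_eq_Iic.symm, two_mul]
  congr 1
  have := (Measure.measurePreserving_neg (volume : Measure ℝ)).setLIntegral_comp_preimage_emb
    (MeasurableEquiv.neg ℝ).measurableEmbedding f (Set.Ioi 0)
  rw [← this]
  simp [hf]

lemma setLIntegral_betaKernel {a b : ℝ} (ha : 0 < a) (hb : 0 < b) :
    ∫⁻ u in Set.Ioo (0 : ℝ) 1, ENNReal.ofReal (u ^ (a - 1) * (1 - u) ^ (b - 1)) =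
      ENNReal.ofReal (Real.Gamma a * Real.Gamma b / Real.Gamma (a + b)) := by
  have h := ProbabilityTheory.lintegral_betaPDF_eq_one ha hb
  have hpos := ProbabilityTheory.beta_pos ha hb
  rw [ProbabilityTheory.lintegral_betaPDF] at h
  simp_rw [mul_assoc] at h
  have : ∀ u : ℝ, ENNReal.ofReal
      (1 / ProbabilityTheory.beta a b * (u ^ (a - 1) * (1 - u) ^ (b - 1))) =
      ENNReal.ofReal (1 / ProbabilityTheory.beta a b) *
        ENNReal.ofReal (u ^ (a - 1) * (1 - u) ^ (b - 1)) := fun u => by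
    rw [ENNReal.ofReal_mul (by positivity)]
  simp_rw [this] at h
  rw [lintegral_const_mul' _ _ ENNReal.ofReal_ne_top] at h
  change _ = ENNReal.ofReal (ProbabilityTheory.beta a b)
  rw [one_div, ENNReal.ofReal_inv_of_pos hpos, ← ENNReal.div_eq_inv_mul] at h
  exact (ENNReal.div_eq_one_iff (by simpa using hpos) ENNReal.ofReal_ne_top).1 h

lemma lintegral_abs_rpow_mul_betaProfile {p β : ℝ} (hp : -1 < p) (hβ : -1 < β) :
    ∫⁻ t : ℝ, ENNReal.ofReal (|t| ^ p) * betaProfile β (t ^ 2) =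
      ENNReal.ofReal (Real.Gamma ((p + 1) / 2) * Real.Gamma (β + 1) /
        Real.Gamma ((p + 1) / 2 + (β + 1))) := by
  rw [lintegral_even _ (fun t => by simp),
    ← setLIntegral_betaKernel (by linarith : 0 < (p + 1) / 2) (by linarith : 0 < β + 1)]
  have himg : (fun x : ℝ => x ^ 2) '' Set.Ioo 0 1 = Set.Ioo 0 1 := by
    ext y
    constructor
    · rintro ⟨x, ⟨h0, h1⟩, rfl⟩
      exact ⟨by positivity, by simp only; nlinarith⟩
    · rintro ⟨h0, h1⟩
      refine ⟨√y, ⟨Real.sqrt_pos.2 h0, ?_⟩, Real.sq_sqrt h0.le⟩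
      rw [Real.sqrt_lt' one_pos]; simpa using h1
  conv_rhs => rw [← himg]
  rw [lintegral_image_eq_lintegral_abs_deriv_mul (f' := fun x => 2 * x) measurableSet_Ioo
    (fun x _ => by simpa using (hasDerivAt_pow 2 x).hasDerivWithinAt)
    (fun x hx y hy h => by
      simpa using (pow_left_inj₀ hx.1.le hy.1.le two_ne_zero).1 h)]
  have hsub : ∫⁻ t in Set.Ioi (0 : ℝ), ENNReal.ofReal (|t| ^ p) * betaProfile β (t ^ 2)
      = ∫⁻ t in Set.Ioo (0 : ℝ) 1, ENNReal.ofReal (|t| ^ p) * betaProfile β (t ^ 2) := by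
    rw [← lintegral_indicator measurableSet_Ioi, ← lintegral_indicator measurableSet_Ioo]
    refine lintegral_congr fun t => ?_
    by_cases h1 : t < 1
    · simp [Set.indicator, h1]
    · simp [Set.indicator, h1, betaProfile_of_one_le (by nlinarith : 1 ≤ t ^ 2)]
  rw [hsub, ← lintegral_const_mul' _ _ ENNReal.ofNat_ne_top]
  refine setLIntegral_congr_fun measurableSet_Ioo ?_
  rintro t ⟨h0, h1⟩
  have h2 : t ^ 2 < 1 := by nlinarith
  simp only [betaProfile, if_pos h2, abs_of_pos h0, abs_of_pos (by positivity : 0 < 2 * t)]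
  rw [← ENNReal.ofReal_mul (by positivity), ← ENNReal.ofReal_mul (by positivity),
    show (2 : ℝ≥0∞) = ENNReal.ofReal 2 by simp, ← ENNReal.ofReal_mul (by positivity)]
  congr 1
  rw [← Real.rpow_natCast t 2, ← Real.rpow_mul h0.le, mul_assoc, ← mul_assoc t,
    show t * t ^ (((2 : ℕ) : ℝ) * ((p + 1) / 2 - 1)) = t ^ p by
      nth_rewrite 1 [← Real.rpow_one t]
      rw [← Real.rpow_add h0]
      push_cast
      ring_nf]
  ring_nf

lemma lintegral_betaProfile_add_sq {β : ℝ} (hβ : -1 < β) (q : ℝ) :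
    ∫⁻ t : ℝ, betaProfile β (q + t ^ 2) =
      ENNReal.ofReal (√Real.pi * Real.Gamma (β + 1) / Real.Gamma (β + 3 / 2)) *
        betaProfile (β + 1 / 2) q := by
  by_cases hq : q < 1
  · have h1 : 0 < 1 - q := by linarith
    rw [lintegral_comp_mul_right_of_pos _ (Real.sqrt_pos.2 h1)]
    have h2 : ∀ u : ℝ, q + (√(1 - q) * u) ^ 2 = q + (1 - q) * u ^ 2 := fun u => by
      rw [mul_pow, Real.sq_sqrt h1.le]
    simp_rw [h2, betaProfile_scale β hq]
    rw [lintegral_const_mul' _ _ ENNReal.ofReal_ne_top]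
    have h3 := lintegral_abs_rpow_mul_betaProfile (p := 0) (by norm_num) hβ
    simp only [Real.rpow_zero, ENNReal.ofReal_one, one_mul] at h3
    rw [h3, ← mul_assoc, mul_comm]
    congr 1
    · norm_num [Real.Gamma_one_half_eq]
      ring_nf
    · rw [betaProfile, if_pos hq, Real.sqrt_eq_rpow, ← ENNReal.ofReal_mul (by positivity),
        ← Real.rpow_add h1]
      ring_nf
  · rw [betaProfile_of_one_le (not_lt.1 hq), mul_zero]
    have : ∀ t : ℝ, betaProfile β (q + t ^ 2) = 0 := fun t =>
      betaProfile_of_one_le (by nlinarith [sq_nonneg t])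
    simp [this]

lemma lintegral_fin_cons {E : Type*} [MeasureSpace E] [SigmaFinite (volume : Measure E)] {n : ℕ}
    {F : (Fin (n + 1) → E) → ℝ≥0∞} (hF : Measurable F) :
    ∫⁻ X, F X = ∫⁻ x : E, ∫⁻ Y : Fin n → E, F (Fin.cons x Y) := by
  have h := (volume_preserving_piFinSuccAbove (fun _ : Fin (n + 1) => E) 0).symm
  rw [← h.lintegral_comp_emb (MeasurableEquiv.measurableEmbedding _), Measure.volume_eq_prod,
    lintegral_prod (fun p => F ((MeasurableEquiv.piFinSuccAbove (fun _ => E) 0).symm p))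
      (hF.comp (MeasurableEquiv.measurable _)).aemeasurable]
  simp [MeasurableEquiv.piFinSuccAbove, Fin.insertNthEquiv]

lemma measurable_fin_cons {E : Type*} [MeasurableSpace E] {n : ℕ} :
    Measurable fun p : E × (Fin n → E) => (Fin.cons p.1 p.2 : Fin (n + 1) → E) := by
  refine measurable_pi_iff.2 fun i => ?_
  refine Fin.cases ?_ (fun j => ?_) i
  · simpa using measurable_fst
  · simp only [Fin.cons_succ]
    fun_prop

lemma lintegral_fin_prod {E : Type*} [MeasureSpace E] [SigmaFinite (volume : Measure E)] {n : ℕ}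
    {f : Fin n → E → ℝ≥0∞} (hf : ∀ i, Measurable (f i)) :
    ∫⁻ X : Fin n → E, ∏ i, f i (X i) = ∏ i, ∫⁻ x, f i x := by
  induction n with
  | zero => simp [lintegral_unique, volume_pi]
  | succ n ih =>
    rw [lintegral_fin_cons (by fun_prop), Fin.prod_univ_succ]
    simp_rw [Fin.prod_univ_succ, Fin.cons_zero, Fin.cons_succ]
    simp_rw [lintegral_const_mul _ (show Measurable fun Y : Fin n → E => ∏ i, f i.succ (Y i) by
      fun_prop), ih fun i => hf i.succ]
    rw [lintegral_mul_const _ (hf 0)]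

lemma lintegral_split_first_column {n m : ℕ} {F : (Fin n → Fin (m + 1) → ℝ) → ℝ≥0∞}
    (hF : Measurable F) :
    ∫⁻ X, F X = ∫⁻ Y : Fin n → Fin m → ℝ, ∫⁻ z : Fin n → ℝ,
      F (fun i => Fin.cons (z i) (Y i)) := by
  have h1 := volume_preserving_pi (ι := Fin n)
    (fun _ => (volume_preserving_piFinSuccAbove (fun _ : Fin (m + 1) => ℝ) 0).symm)
  have h2 := (volume_measurePreserving_arrowProdEquivProdArrow ℝ (Fin m → ℝ) (Fin n)).symm
  have h3 := h1.comp h2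
  have hm : Measurable fun p : (Fin n → ℝ) × (Fin n → Fin m → ℝ) =>
      F (fun i => Fin.cons (p.1 i) (p.2 i)) := by
    refine hF.comp (measurable_pi_iff.2 fun i => ?_)
    exact measurable_fin_cons.comp (f := fun p : (Fin n → ℝ) × (Fin n → Fin m → ℝ) =>
      (p.1 i, p.2 i)) (by fun_prop)
  rw [← h3.lintegral_comp hF, Measure.volume_eq_prod, ← lintegral_prod_symm _ hm.aemeasurable]
  refine lintegral_congr fun p => congrArg F (funext fun i => ?_)
  simp [MeasurableEquiv.piFinSuccAbove, Fin.insertNthEquiv, MeasurableEquiv.arrowProdEquivProdArrow,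
    Equiv.arrowProdEquivProdArrow]

lemma lintegral_comp_linearMap {E : Type*} [NormedAddCommGroup E] [NormedSpace ℝ E]
    [MeasureSpace E] [BorelSpace E] [FiniteDimensional ℝ E]
    [(volume : Measure E).IsAddHaarMeasure] (f : E →ₗ[ℝ] E) (hf : LinearMap.det f ≠ 0)
    (F : E → ℝ≥0∞) :
    ∫⁻ x, F x = ENNReal.ofReal |LinearMap.det f| * ∫⁻ x, F (f x) := by
  have h := Measure.map_linearMap_addHaar_eq_smul_addHaar (volume : Measure E) hf
  have e : MeasurableEmbedding f :=
    (f.equivOfDetNeZero hf).toContinuousLinearEquiv.toHomeomorph.measurableEmbedding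
  rw [← e.lintegral_map, h, lintegral_smul_measure, smul_eq_mul, ← mul_assoc,
    ← ENNReal.ofReal_mul (abs_nonneg _), ← abs_mul, mul_inv_cancel₀ hf]
  simp

lemma lintegral_comp_mulVec {n : ℕ} {P : Matrix (Fin n) (Fin n) ℝ} (hP : P.det ≠ 0)
    (F : (Fin n → ℝ) → ℝ≥0∞) :
    ∫⁻ x, F x = ENNReal.ofReal |P.det| * ∫⁻ x, F (P.mulVec x) := by
  have h := lintegral_comp_linearMap (Matrix.toLin' P) (by simpa using hP) F
  simpa using h

lemma lintegral_comp_affine_rows {n d : ℕ} {C : Matrix (Fin d) (Fin d) ℝ} (hC : C.det ≠ 0)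
    (v : Fin d → ℝ) (F : (Fin n → Fin d → ℝ) → ℝ≥0∞) :
    ∫⁻ Y, F Y = ENNReal.ofReal (|C.det| ^ n) *
      ∫⁻ W : Fin n → Fin d → ℝ, F (fun i => v + C.mulVec (W i)) := by
  rw [← lintegral_add_left_eq_self F (fun _ => v)]
  have hdet : LinearMap.det (LinearMap.pi fun i : Fin n =>
      (Matrix.toLin' C).comp (LinearMap.proj i)) = C.det ^ n := by
    rw [LinearMap.det_pi]
    simp
  rw [lintegral_comp_linearMap (LinearMap.pi fun i : Fin n =>
      (Matrix.toLin' C).comp (LinearMap.proj i)) (by rw [hdet]; exact pow_ne_zero _ hC), hdet,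
    abs_pow]
  rfl

lemma ae_det_ne_zero (n : ℕ) : ∀ᵐ X : Fin n → Fin n → ℝ, (Matrix.of X).det ≠ 0 := by
  have hcont : Continuous fun X : Fin n → Fin n → ℝ => (Matrix.of X).det :=
    Continuous.matrix_det continuous_id
  have hS : MeasurableSet {X : Fin n → Fin n → ℝ | (Matrix.of X).det = 0} :=
    hcont.measurable (measurableSet_singleton 0)
  set S := {X : Fin n → Fin n → ℝ | (Matrix.of X).det = 0} with hSdef
  let I : Fin n → Fin n → ℝ := (1 : Matrix (Fin n) (Fin n) ℝ)
  have hfin : ∀ X : Fin n → Fin n → ℝ, {t : ℝ | t • I + X ∈ S}.Finite := fun X => by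
    have : {t : ℝ | t • I + X ∈ S} = {t : ℝ | (Matrix.charpoly (-Matrix.of X)).IsRoot t} := by
      ext t
      simp only [hSdef, Set.mem_ofPred_eq, Polynomial.IsRoot, Matrix.eval_charpoly, sub_neg_eq_add]
      rw [Matrix.scalar_apply, ← Matrix.smul_one_eq_diagonal]
      rfl
    rw [this]
    exact Polynomial.finite_setOfPred_isRoot (Matrix.charpoly_monic _).ne_zero
  have hm : Measurable fun p : ℝ × (Fin n → Fin n → ℝ) =>
      S.indicator (1 : (Fin n → Fin n → ℝ) → ℝ≥0∞) (p.1 • I + p.2) :=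
    (measurable_one.indicator hS).comp (by fun_prop)
  have h0 : ∫⁻ t : ℝ, ∫⁻ X : Fin n → Fin n → ℝ,
      S.indicator (1 : (Fin n → Fin n → ℝ) → ℝ≥0∞) (t • I + X) = 0 := by
    rw [lintegral_lintegral_swap hm.aemeasurable]
    refine (lintegral_congr fun X => ?_).trans lintegral_zero
    have : (fun t : ℝ => S.indicator (1 : (Fin n → Fin n → ℝ) → ℝ≥0∞) (t • I + X)) =
        {t : ℝ | t • I + X ∈ S}.indicator 1 := by
      ext t; simp [Set.indicator]
    rw [this, lintegral_indicator_one (hfin X).measurableSet]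
    exact (hfin X).measure_zero _
  simp_rw [fun t : ℝ => lintegral_add_left_eq_self (μ := volume)
    (S.indicator (1 : (Fin n → Fin n → ℝ) → ℝ≥0∞))
    (t • I), lintegral_indicator_one hS] at h0
  have : volume S = 0 := by simpa using h0
  exact measure_eq_zero_iff_ae_notMem.1 this

lemma dotProduct_cons_self {n : ℕ} (t : ℝ) (y : Fin n → ℝ) :
    (Fin.cons t y : Fin (n + 1) → ℝ) ⬝ᵥ (Fin.cons t y : Fin (n + 1) → ℝ) = y ⬝ᵥ y + t ^ 2 := by
  simp [dotProduct, Fin.sum_univ_succ]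
  ring

lemma measurable_dotProduct_self (n : ℕ) : Measurable fun x : Fin n → ℝ => x ⬝ᵥ x := by
  unfold dotProduct
  fun_prop

lemma eq_ofReal_div_of_mul_eq {x : ℝ≥0∞} {b c : ℝ} (hb : 0 < b)
    (h : x * ENNReal.ofReal b = ENNReal.ofReal c) : x = ENNReal.ofReal (c / b) := by
  rw [ENNReal.ofReal_div_of_pos hb, ENNReal.eq_div_iff (by simpa using hb) ENNReal.ofReal_ne_top,
    mul_comm, h]

lemma lintegral_betaProfile_dotProduct (n : ℕ) {β : ℝ} (hβ : -1 < β) :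
    ∫⁻ x : Fin n → ℝ, betaProfile β (x ⬝ᵥ x) =
      ENNReal.ofReal (Real.pi ^ ((n : ℝ) / 2) * Real.Gamma (β + 1) /
        Real.Gamma ((n : ℝ) / 2 + β + 1)) := by
  induction n generalizing β with
  | zero =>
    have : Real.Gamma (β + 1) ≠ 0 := (Real.Gamma_pos_of_pos (by linarith)).ne'
    simp [lintegral_unique, volume_pi, betaProfile, this]
  | succ n ih =>
    have hm : Measurable fun x : Fin (n + 1) → ℝ => betaProfile β (x ⬝ᵥ x) :=
      (measurable_betaProfile β).comp (measurable_dotProduct_self (n + 1))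
    have hm' : Measurable fun p : ℝ × (Fin n → ℝ) =>
      betaProfile β ((Fin.cons p.1 p.2 : Fin (n + 1) → ℝ) ⬝ᵥ (Fin.cons p.1 p.2)) :=
        hm.comp measurable_fin_cons
    have h1 := Real.Gamma_pos_of_pos (by linarith : 0 < β + 3 / 2)
    have h2 : (0 : ℝ) ≤ n := n.cast_nonneg
    have h3 := Real.Gamma_pos_of_pos (by linarith : 0 < (n : ℝ) / 2 + β + 3 / 2)
    have h4 := Real.Gamma_pos_of_pos (by linarith : 0 < β + 1)
    rw [lintegral_fin_cons hm, lintegral_lintegral_swap hm'.aemeasurable]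
    simp_rw [dotProduct_cons_self, lintegral_betaProfile_add_sq hβ]
    rw [lintegral_const_mul' _ _ ENNReal.ofReal_ne_top, ih (by linarith),
      ← ENNReal.ofReal_mul (by positivity)]
    congr 1
    push_cast
    rw [add_div, Real.rpow_add Real.pi_pos, ← Real.sqrt_eq_rpow,
      show β + 1 / 2 + 1 = β + 3 / 2 by ring,
      show (n : ℝ) / 2 + (β + 1 / 2) + 1 = n / 2 + β + 3 / 2 by ring,
      show (n : ℝ) / 2 + 1 / 2 + β + 1 = n / 2 + β + 3 / 2 by ring]
    generalize Real.Gamma (β + 3 / 2) = g1 at *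
    generalize Real.Gamma ((n : ℝ) / 2 + β + 3 / 2) = g3 at *
    field_simp

lemma lintegral_radial_eq_mul (d : ℕ) {β s : ℝ} (hβ : -1 < β) (hs : -1 < d + s) :
    ∫⁻ x : Fin (d + 1) → ℝ, ENNReal.ofReal (√(x ⬝ᵥ x) ^ s) * betaProfile β (x ⬝ᵥ x) =
      (∫⁻ a : Fin d → ℝ, ENNReal.ofReal ((√(1 + a ⬝ᵥ a) ^ (d + 1))⁻¹)) *
        ENNReal.ofReal (Real.Gamma ((d + s + 1) / 2) * Real.Gamma (β + 1) /
          Real.Gamma ((d + s + 1) / 2 + (β + 1))) := by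
  have hd1 := measurable_dotProduct_self (d + 1)
  have hd := measurable_dotProduct_self d
  have hb := measurable_betaProfile β
  rw [lintegral_fin_cons (by fun_prop), ← lintegral_abs_rpow_mul_betaProfile hs hβ]
  simp_rw [dotProduct_cons_self]
  have h1 : ∀ᵐ t : ℝ, ∫⁻ y : Fin d → ℝ,
      ENNReal.ofReal (√(y ⬝ᵥ y + t ^ 2) ^ s) * betaProfile β (y ⬝ᵥ y + t ^ 2) =
      ∫⁻ a : Fin d → ℝ, ENNReal.ofReal (|t| ^ d) * (ENNReal.ofReal ((|t| * √(1 + a ⬝ᵥ a)) ^ s) *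
        betaProfile β ((t * √(1 + a ⬝ᵥ a)) ^ 2)) := by
    filter_upwards [compl_mem_ae_iff.2 (measure_singleton (0 : ℝ))] with t ht
    have ht : t ≠ 0 := ht
    have hdet : (t • (1 : Matrix (Fin d) (Fin d) ℝ)).det = t ^ d := by simp
    rw [lintegral_comp_mulVec (P := t • 1) (by rw [hdet]; positivity), hdet, abs_pow,
      lintegral_const_mul' _ _ ENNReal.ofReal_ne_top]
    congr 1
    refine lintegral_congr fun a => ?_
    have h0 : 0 ≤ 1 + a ⬝ᵥ a := by
      have : 0 ≤ a ⬝ᵥ a := Finset.sum_nonneg fun i _ => mul_self_nonneg _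
      linarith
    have hq : ((t • (1 : Matrix (Fin d) (Fin d) ℝ)).mulVec a) ⬝ᵥ
        ((t • (1 : Matrix (Fin d) (Fin d) ℝ)).mulVec a) + t ^ 2 = (t * √(1 + a ⬝ᵥ a)) ^ 2 := by
      rw [mul_pow, Real.sq_sqrt h0, Matrix.smul_mulVec, Matrix.one_mulVec, dotProduct_smul,
        smul_dotProduct]
      simp only [smul_eq_mul]
      ring
    rw [hq, Real.sqrt_sq_eq_abs, abs_mul, abs_of_nonneg (Real.sqrt_nonneg _)]
  rw [lintegral_congr_ae h1, lintegral_lintegral_swap (by fun_prop),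
    ← lintegral_mul_const _ (by fun_prop)]
  refine lintegral_congr fun a => ?_
  have h0 : 0 < 1 + a ⬝ᵥ a := by
    have : 0 ≤ a ⬝ᵥ a := Finset.sum_nonneg fun i _ => mul_self_nonneg _
    linarith
  set σ := √(1 + a ⬝ᵥ a) with hσ
  have hσ0 : 0 < σ := Real.sqrt_pos.2 h0
  rw [lintegral_comp_mul_right_of_pos _ (inv_pos.2 hσ0),
    ← lintegral_const_mul' _ _ ENNReal.ofReal_ne_top,
    ← lintegral_const_mul' _ _ ENNReal.ofReal_ne_top]
  refine lintegral_congr_ae ?_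
  filter_upwards [compl_mem_ae_iff.2 (measure_singleton (0 : ℝ))] with t ht
  have ht : 0 < |t| := abs_pos.2 ht
  have e1 : σ⁻¹ * t * σ = t := by field_simp
  have e2 : |σ⁻¹ * t| * σ = |t| := by
    rw [abs_mul, abs_of_pos (inv_pos.2 hσ0)]; field_simp
  rw [e1, e2, ← mul_assoc, ← mul_assoc, ← mul_assoc]
  congr 1
  rw [← ENNReal.ofReal_mul (by positivity), ← ENNReal.ofReal_mul (by positivity),
    ← ENNReal.ofReal_mul (by positivity)]
  congr 1
  rw [abs_mul, abs_of_pos (inv_pos.2 hσ0), Real.rpow_add ht, Real.rpow_natCast,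
    mul_pow, inv_pow, pow_succ]
  field_simp

lemma lintegral_inv_sqrt_pow (d : ℕ) :
    ∫⁻ a : Fin d → ℝ, ENNReal.ofReal ((√(1 + a ⬝ᵥ a) ^ (d + 1))⁻¹) =
      ENNReal.ofReal (Real.pi ^ (((d : ℝ) + 1) / 2) / Real.Gamma (((d : ℝ) + 1) / 2)) := by
  have hd : (0 : ℝ) ≤ d := d.cast_nonneg
  have h1 := Real.Gamma_pos_of_pos (by positivity : 0 < ((d : ℝ) + 1) / 2)
  have h2 := Real.Gamma_pos_of_pos (by positivity : 0 < ((d : ℝ) + 1) / 2 + 1)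
  have h := lintegral_radial_eq_mul d (β := 0) (s := 0) (by norm_num) (by linarith)
  simp only [Real.rpow_zero, ENNReal.ofReal_one, one_mul] at h
  rw [lintegral_betaProfile_dotProduct _ (by norm_num)] at h
  simp only [add_zero, zero_add, Real.Gamma_one, mul_one] at h
  rw [eq_ofReal_div_of_mul_eq (by positivity) h.symm]
  congr 1
  push_cast
  field_simp

lemma lintegral_radial (d : ℕ) {β s : ℝ} (hβ : -1 < β) (hs : -1 < d + s) :
    ∫⁻ x : Fin (d + 1) → ℝ, ENNReal.ofReal (√(x ⬝ᵥ x) ^ s) * betaProfile β (x ⬝ᵥ x) =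
      ENNReal.ofReal (Real.pi ^ (((d : ℝ) + 1) / 2) / Real.Gamma (((d : ℝ) + 1) / 2) *
        (Real.Gamma ((d + s + 1) / 2) * Real.Gamma (β + 1) /
          Real.Gamma ((d + s + 1) / 2 + (β + 1)))) := by
  have h1 := Real.Gamma_pos_of_pos (by positivity : 0 < ((d : ℝ) + 1) / 2)
  rw [lintegral_radial_eq_mul d hβ hs, lintegral_inv_sqrt_pow,
    ← ENNReal.ofReal_mul (by positivity)]

lemma exists_orthogonal_mulVec_single {n : ℕ} (u : Fin (n + 1) → ℝ) (hu : u ⬝ᵥ u = 1) :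
    ∃ Q : Matrix (Fin (n + 1)) (Fin (n + 1)) ℝ, Q.transpose * Q = 1 ∧
      Q.mulVec (Pi.single 0 1) = u := by
  set e : Fin (n + 1) → ℝ := Pi.single 0 1 with he
  have hee : e ⬝ᵥ e = 1 := by simp [he]
  set v := e - u with hv
  have hvv : v ⬝ᵥ v = 2 * (v ⬝ᵥ e) := by
    simp only [hv, sub_dotProduct, dotProduct_sub, hee, hu, dotProduct_comm e u]
    ring
  by_cases h0 : v ⬝ᵥ e = 0
  · have : v = 0 := dotProduct_self_eq_zero.1 (by rw [hvv, h0, mul_zero])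
    refine ⟨1, by simp, ?_⟩
    rw [Matrix.one_mulVec]
    exact sub_eq_zero.1 this
  · refine ⟨1 - (v ⬝ᵥ e)⁻¹ • Matrix.vecMulVec v v, ?_, ?_⟩
    · rw [Matrix.transpose_sub, Matrix.transpose_smul, Matrix.transpose_vecMulVec,
        Matrix.transpose_one, sub_mul, mul_sub, mul_sub, one_mul, mul_one, one_mul,
        smul_mul_smul_comm, Matrix.vecMulVec_mul_vecMulVec, hvv, Matrix.vecMulVec_smul, smul_smul,
        show (v ⬝ᵥ e)⁻¹ * (v ⬝ᵥ e)⁻¹ * (2 * (v ⬝ᵥ e)) = 2 * (v ⬝ᵥ e)⁻¹ by field_simp, mul_smul,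
        two_smul]
      abel
    · rw [Matrix.sub_mulVec, Matrix.one_mulVec, Matrix.smul_mulVec, Matrix.vecMulVec_mulVec,
        op_smul_eq_smul, smul_smul, inv_mul_cancel₀ h0, one_smul, hv]
      abel

/-- The (unnormalized) moment of order `s` of the absolute determinant of `n` beta points. -/
noncomputable def detMoment (n : ℕ) (β s : ℝ) : ℝ≥0∞ :=
  ∫⁻ X : Fin n → Fin n → ℝ,
    ENNReal.ofReal (|(Matrix.of X).det| ^ s) * ∏ i, betaProfile β (X i ⬝ᵥ X i)

lemma measurable_det_of (n : ℕ) :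
    Measurable fun X : Fin n → Fin n → ℝ => (Matrix.of X).det := by
  have h : Continuous fun X : Fin n → Fin n → ℝ => (Matrix.of X).det :=
    Continuous.matrix_det continuous_id
  exact h.measurable

lemma measurable_detMoment_integrand (n : ℕ) (β s : ℝ) :
    Measurable fun X : Fin n → Fin n → ℝ =>
      ENNReal.ofReal (|(Matrix.of X).det| ^ s) * ∏ i, betaProfile β (X i ⬝ᵥ X i) := by
  have h1 := measurable_dotProduct_self n
  have h2 := measurable_betaProfile β
  have h3 := measurable_det_of n
  have h4 : Measurable fun X : Fin n → Fin n → ℝ => |(Matrix.of X).det| :=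
    continuous_abs.measurable.comp h3
  fun_prop

lemma detMoment_zero (β s : ℝ) : detMoment 0 β s = 1 := by
  simp [detMoment, lintegral_unique, volume_pi]

lemma mulVec_dotProduct_self_of_orthogonal {n : ℕ} {Q : Matrix (Fin n) (Fin n) ℝ}
    (hQ : Q.transpose * Q = 1) (w : Fin n → ℝ) : Q.mulVec w ⬝ᵥ Q.mulVec w = w ⬝ᵥ w := by
  rw [Matrix.dotProduct_mulVec, ← Matrix.mulVec_transpose, Matrix.mulVec_mulVec, hQ,
    Matrix.one_mulVec]

lemma det_of_mulVec {n : ℕ} (C : Matrix (Fin n) (Fin n) ℝ) (W : Fin n → Fin n → ℝ) :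
    (Matrix.of fun i => C.mulVec (W i)).det = C.det * (Matrix.of W).det := by
  have : (Matrix.of fun i => C.mulVec (W i)) = Matrix.of W * C.transpose := by
    ext i j
    simp [Matrix.mul_apply, Matrix.mulVec, dotProduct, mul_comm]
  rw [this, Matrix.det_mul, Matrix.det_transpose, mul_comm]

lemma det_cons_single_cons {n : ℕ} (r : ℝ) (z : Fin n → ℝ) (Y : Fin n → Fin n → ℝ) :
    (Matrix.of (Fin.cons (r • Pi.single 0 1) fun i => Fin.cons (z i) (Y i) :
      Fin (n + 1) → Fin (n + 1) → ℝ)).det = r * (Matrix.of Y).det := by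
  rw [Matrix.det_succ_row_zero, Fin.sum_univ_succ]
  simp only [Matrix.of_apply, Fin.cons_zero, Pi.smul_apply, Pi.single_eq_same, Fin.succ_ne_zero,
    ne_eq, not_false_eq_true, Pi.single_eq_of_ne, mul_zero, zero_mul,
    Finset.sum_const_zero, add_zero, smul_eq_mul, mul_one, Fin.val_zero, pow_zero, one_mul]
  congr 2

lemma lintegral_det_cons {n : ℕ} {β : ℝ} (hβ : -1 < β) (s : ℝ) {x : Fin (n + 1) → ℝ}
    (hx : x ≠ 0) :
    ∫⁻ Y : Fin n → Fin (n + 1) → ℝ,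
      ENNReal.ofReal (|(Matrix.of (Fin.cons x Y : Fin (n + 1) → Fin (n + 1) → ℝ)).det| ^ s) *
        ∏ i, betaProfile β (Y i ⬝ᵥ Y i) =
      ENNReal.ofReal (√(x ⬝ᵥ x) ^ s) *
        (ENNReal.ofReal (√Real.pi * Real.Gamma (β + 1) / Real.Gamma (β + 3 / 2)) ^ n *
          detMoment n (β + 1 / 2) s) := by
  set r := √(x ⬝ᵥ x) with hr
  have hxx : 0 < x ⬝ᵥ x :=
    lt_of_le_of_ne (Finset.sum_nonneg fun i _ => mul_self_nonneg _)
      (Ne.symm (mt dotProduct_self_eq_zero.1 hx))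
  have hr0 : 0 < r := Real.sqrt_pos.2 hxx
  have hrr : r * r = x ⬝ᵥ x := Real.mul_self_sqrt hxx.le
  obtain ⟨Q, hQ, hQx⟩ := exists_orthogonal_mulVec_single (r⁻¹ • x) (by
    rw [dotProduct_smul, smul_dotProduct, ← hrr, smul_eq_mul, smul_eq_mul]
    field_simp)
  have hQdet : |Q.det| = 1 := by
    have := congrArg Matrix.det hQ
    rw [Matrix.det_mul, Matrix.det_transpose, Matrix.det_one, ← abs_mul_abs_self] at this
    nlinarith [abs_nonneg Q.det]
  have hQ0 : Q.det ≠ 0 := fun h => by simp [h] at hQdet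
  have hxQ : x = Q.mulVec (r • Pi.single 0 1) := by
    rw [Matrix.mulVec_smul, hQx, smul_smul, mul_inv_cancel₀ hr0.ne', one_smul]
  have hdet : ∀ W : Fin n → Fin (n + 1) → ℝ,
      |(Matrix.of (Fin.cons x (fun i => Q.mulVec (W i)) : Fin (n + 1) → Fin (n + 1) → ℝ)).det| =
        |(Matrix.of (Fin.cons (r • Pi.single 0 1) W : Fin (n + 1) → Fin (n + 1) → ℝ)).det| := by
    intro W
    suffices h : (Matrix.of (Fin.cons x (fun i => Q.mulVec (W i)) :
        Fin (n + 1) → Fin (n + 1) → ℝ)).det = Q.det * (Matrix.of (Fin.cons (r • Pi.single 0 1) W :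
          Fin (n + 1) → Fin (n + 1) → ℝ)).det by
      rw [h, abs_mul, hQdet, one_mul]
    rw [← det_of_mulVec]
    congr 2
    funext i
    refine Fin.cases ?_ (fun j => ?_) i
    · simp only [Fin.cons_zero]; exact hxQ
    · simp
  rw [lintegral_comp_affine_rows hQ0 0, hQdet]
  simp only [one_pow, ENNReal.ofReal_one, one_mul, zero_add, hdet,
    mulVec_dotProduct_self_of_orthogonal hQ]
  have h1 := measurable_dotProduct_self (n + 1)
  have h2 := measurable_betaProfile β
  have h3 : Measurable fun W : Fin n → Fin (n + 1) → ℝ =>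
      |(Matrix.of (Fin.cons (r • Pi.single 0 1) W : Fin (n + 1) → Fin (n + 1) → ℝ)).det| :=
    continuous_abs.measurable.comp ((measurable_det_of (n + 1)).comp
      (measurable_fin_cons.comp (f := fun W : Fin n → Fin (n + 1) → ℝ => (r • Pi.single 0 1, W))
        (by fun_prop)))
  rw [lintegral_split_first_column (by fun_prop), detMoment,
    ← lintegral_const_mul _ (measurable_detMoment_integrand _ _ _),
    ← lintegral_const_mul' _ _ ENNReal.ofReal_ne_top]
  refine lintegral_congr fun Y => ?_
  simp_rw [det_cons_single_cons, dotProduct_cons_self]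
  rw [lintegral_const_mul' _ _ ENNReal.ofReal_ne_top,
    lintegral_fin_prod (f := fun i t => betaProfile β (Y i ⬝ᵥ Y i + t ^ 2)) (by fun_prop)]
  simp_rw [lintegral_betaProfile_add_sq hβ]
  rw [Finset.prod_mul_distrib, Finset.prod_const, Finset.card_univ, Fintype.card_fin, abs_mul,
    abs_of_pos hr0, Real.mul_rpow hr0.le (abs_nonneg _), ENNReal.ofReal_mul (by positivity)]
  ring

lemma detMoment_succ (n : ℕ) {β s : ℝ} (hβ : -1 < β) (hs : -1 < n + s) :
    detMoment (n + 1) β s =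
      ENNReal.ofReal (Real.pi ^ (((n : ℝ) + 1) / 2) / Real.Gamma (((n : ℝ) + 1) / 2) *
        (Real.Gamma ((n + s + 1) / 2) * Real.Gamma (β + 1) /
          Real.Gamma ((n + s + 1) / 2 + (β + 1)))) *
        (ENNReal.ofReal (√Real.pi * Real.Gamma (β + 1) / Real.Gamma (β + 3 / 2)) ^ n *
          detMoment n (β + 1 / 2) s) := by
  have h1 := measurable_dotProduct_self (n + 1)
  have h2 := measurable_betaProfile β
  rw [← lintegral_radial n hβ hs, ← lintegral_mul_const _ (by fun_prop), detMoment,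
    lintegral_fin_cons (measurable_detMoment_integrand _ _ _)]
  refine lintegral_congr_ae ?_
  filter_upwards [compl_mem_ae_iff.2 (measure_singleton (0 : Fin (n + 1) → ℝ))] with x hx
  have h3 : Measurable fun Y : Fin n → Fin (n + 1) → ℝ =>
      |(Matrix.of (Fin.cons x Y : Fin (n + 1) → Fin (n + 1) → ℝ)).det| :=
    continuous_abs.measurable.comp ((measurable_det_of (n + 1)).comp
      (measurable_fin_cons.comp (f := fun Y : Fin n → Fin (n + 1) → ℝ => (x, Y))
        (by fun_prop)))
  simp_rw [Fin.prod_univ_succ, Fin.cons_zero, Fin.cons_succ, mul_left_comm _ (betaProfile β (x ⬝ᵥ x))]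
  rw [lintegral_const_mul _ (by fun_prop), lintegral_det_cons hβ s hx]
  ring

lemma detMoment_eq (n : ℕ) {β s : ℝ} (hβ : -1 < β) (hs : -1 < s) :
    detMoment n β s = ENNReal.ofReal (Real.pi ^ ((n : ℝ) ^ 2 / 2) *
      (Real.Gamma (β + 1) / Real.Gamma ((n + s) / 2 + β + 1)) ^ n *
      ∏ i ∈ Finset.range n, Real.Gamma ((i + 1 + s) / 2) / Real.Gamma (((i : ℝ) + 1) / 2)) := by
  induction n generalizing β with
  | zero => simp [detMoment_zero]
  | succ n ih =>
    have hn : (0 : ℝ) ≤ n := n.cast_nonneg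
    have g1 := Real.Gamma_pos_of_pos (by positivity : 0 < ((n : ℝ) + 1) / 2)
    have g2 := Real.Gamma_pos_of_pos (by linarith : 0 < β + 1)
    have g3 := Real.Gamma_pos_of_pos (by linarith : 0 < β + 3 / 2)
    have g4 := Real.Gamma_pos_of_pos (by linarith : 0 < ((n : ℝ) + 1 + s) / 2)
    have g5 := Real.Gamma_pos_of_pos (by linarith : 0 < ((n : ℝ) + 1 + s) / 2 + β + 1)
    rw [detMoment_succ n hβ (by linarith), ih (by linarith), ← ENNReal.ofReal_pow (by positivity),
      ← ENNReal.ofReal_mul (by positivity),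
      show ((n : ℝ) + s + 1) / 2 = (n + 1 + s) / 2 by ring,
      show ((n : ℝ) + 1 + s) / 2 + (β + 1) = (n + 1 + s) / 2 + β + 1 by ring,
      show ((n : ℝ) + s) / 2 + (β + 1 / 2) + 1 = (n + 1 + s) / 2 + β + 1 by ring,
      show β + 1 / 2 + 1 = β + 3 / 2 by ring, ← ENNReal.ofReal_mul (by positivity),
      Finset.prod_range_succ]
    congr 1
    have hpi : Real.pi ^ (((n + 1 : ℕ) : ℝ) ^ 2 / 2) =
        Real.pi ^ (((n : ℝ) + 1) / 2) * √Real.pi ^ n * Real.pi ^ ((n : ℝ) ^ 2 / 2) := by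
      rw [Real.sqrt_eq_rpow, ← Real.rpow_natCast (Real.pi ^ (1 / 2 : ℝ)) n,
        ← Real.rpow_mul Real.pi_pos.le,
        ← Real.rpow_add Real.pi_pos, ← Real.rpow_add Real.pi_pos]
      push_cast
      ring_nf
    rw [hpi]
    push_cast
    generalize Real.Gamma (β + 1) = a2 at *
    generalize Real.Gamma (β + 3 / 2) = a3 at *
    generalize Real.Gamma (((n : ℝ) + 1 + s) / 2) = a4 at *
    generalize Real.Gamma (((n : ℝ) + 1 + s) / 2 + β + 1) = a5 at *
    rw [div_pow, div_pow, div_pow, mul_pow, pow_succ, pow_succ]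
    field_simp
    ring

/-- `d!` times the signed volume of the simplex with the given vertices. -/
noncomputable def edgeDet {d : ℕ} (X : Fin (d + 1) → Fin d → ℝ) : ℝ :=
  (Matrix.of fun i j : Fin d => X i.succ j - X 0 j).det

/-- The (unnormalized) moment of order `κ` of `d!` times the volume of a beta simplex. -/
noncomputable def simplexMoment (d : ℕ) (β κ : ℝ) : ℝ≥0∞ :=
  ∫⁻ X : Fin (d + 1) → Fin d → ℝ,
    ENNReal.ofReal (|edgeDet X| ^ κ) * ∏ i, betaProfile β (X i ⬝ᵥ X i)

lemma measurable_edgeDet (d : ℕ) : Measurable (edgeDet (d := d)) :=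
  (measurable_det_of d).comp (f := fun (X : Fin (d + 1) → Fin d → ℝ)
    (i j : Fin d) => X i.succ j - X 0 j) (by fun_prop)

lemma edgeDet_affine {d : ℕ} (v : Fin d → ℝ) (C : Matrix (Fin d) (Fin d) ℝ)
    (W : Fin (d + 1) → Fin d → ℝ) :
    edgeDet (fun i => v + C.mulVec (W i)) = C.det * edgeDet W := by
  unfold edgeDet
  rw [show (Matrix.of fun i j : Fin d => W i.succ j - W 0 j) =
    Matrix.of (fun i => W i.succ - W 0) from rfl, ← det_of_mulVec]
  congr 1
  ext i j
  simp [Matrix.mulVec_sub]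

lemma det_cons_one {d : ℕ} (Y : Fin (d + 1) → Fin d → ℝ) :
    (Matrix.of fun i => (Fin.cons 1 (Y i) : Fin (d + 1) → ℝ)).det = edgeDet Y := by
  rw [← Matrix.det_eq_of_forall_row_eq_smul_add_const
    (A := Matrix.of (Fin.cons (Fin.cons 1 (Y 0)) fun i => Fin.cons 0 (Y i.succ - Y 0) :
      Fin (d + 1) → Fin (d + 1) → ℝ)) (Fin.cons 0 fun _ => -1) 0 (by simp),
    Matrix.det_succ_column_zero, Fin.sum_univ_succ]
  · simp [edgeDet]
    rfl
  · intro i j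
    refine Fin.cases ?_ (fun i => ?_) i <;> refine Fin.cases ?_ (fun j => ?_) j <;> simp
    ring

lemma det_cons_mulVec {d : ℕ} (Y : Fin (d + 1) → Fin d → ℝ) (w : Fin (d + 1) → ℝ) :
    (Matrix.of fun i => (Fin.cons
      ((Matrix.of fun i => (Fin.cons 1 (Y i) : Fin (d + 1) → ℝ)).mulVec w i) (Y i) :
        Fin (d + 1) → ℝ)).det = edgeDet Y * w 0 := by
  rw [← det_cons_one]
  set P := Matrix.of fun i => (Fin.cons 1 (Y i) : Fin (d + 1) → ℝ) with hP
  have : (Matrix.of fun i => (Fin.cons (P.mulVec w i) (Y i) : Fin (d + 1) → ℝ)) =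
      P.updateCol 0 (P.mulVec w) := by
    ext i j
    refine Fin.cases ?_ (fun j => ?_) j
    · simp
    · simp [hP]
  rw [this, ← Matrix.cramer_apply, Matrix.cramer_eq_adjugate_mulVec, Matrix.mulVec_mulVec,
    Matrix.adjugate_mul, Matrix.smul_mulVec, Matrix.one_mulVec, Pi.smul_apply, smul_eq_mul]

lemma ae_edgeDet_ne_zero (d : ℕ) : ∀ᵐ Y : Fin (d + 1) → Fin d → ℝ, edgeDet Y ≠ 0 := by
  have hS : MeasurableSet {X : Fin d → Fin d → ℝ | (Matrix.of X).det = 0} :=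
    measurable_det_of d (measurableSet_singleton 0)
  have hT : MeasurableSet {Y : Fin (d + 1) → Fin d → ℝ | edgeDet Y = 0} :=
    measurable_edgeDet d (measurableSet_singleton 0)
  have h0 : volume {X : Fin d → Fin d → ℝ | (Matrix.of X).det = 0} = 0 :=
    measure_eq_zero_iff_ae_notMem.2 (ae_det_ne_zero d)
  refine measure_eq_zero_iff_ae_notMem.1 (?_ : volume {Y | edgeDet Y = 0} = 0)
  rw [← lintegral_indicator_one hT, lintegral_fin_cons (measurable_one.indicator hT)]
  refine (lintegral_congr fun x => ?_).trans lintegral_zero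
  rw [← h0, ← lintegral_indicator_one hS,
    ← lintegral_sub_right_eq_self (μ := volume)
      ({X : Fin d → Fin d → ℝ | (Matrix.of X).det = 0}.indicator 1) (fun _ : Fin d => x)]
  rfl

lemma exists_section_parametrization {d : ℕ} (a : Fin d → ℝ) :
    ∃ B : Matrix (Fin d) (Fin d) ℝ, B.det = (√(1 + a ⬝ᵥ a))⁻¹ ∧
      ∀ w, B.mulVec w ⬝ᵥ B.mulVec w + (a ⬝ᵥ B.mulVec w) ^ 2 = w ⬝ᵥ w := by
  have h0 : 0 ≤ a ⬝ᵥ a := Finset.sum_nonneg fun i _ => mul_self_nonneg _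
  set σ := √(1 + a ⬝ᵥ a) with hσ
  have hσ0 : 0 < σ := Real.sqrt_pos.2 (by linarith)
  have haa : a ⬝ᵥ a = σ ^ 2 - 1 := by rw [hσ, Real.sq_sqrt (by linarith)]; ring
  set c := (σ * (1 + σ))⁻¹ with hc
  refine ⟨1 + Matrix.vecMulVec ((-c) • a) a, ?_, fun w => ?_⟩
  · rw [Matrix.vecMulVec_eq Unit, Matrix.det_one_add_replicateCol_mul_replicateRow,
      dotProduct_smul, haa, hc, smul_eq_mul]
    field_simp
    ring
  · have hB : (1 + Matrix.vecMulVec ((-c) • a) a).mulVec w = w - (c * (a ⬝ᵥ w)) • a := by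
      rw [Matrix.add_mulVec, Matrix.one_mulVec, Matrix.vecMulVec_mulVec, op_smul_eq_smul,
        smul_smul, mul_neg, neg_smul, ← sub_eq_add_neg, mul_comm]
    rw [hB]
    simp only [sub_dotProduct, dotProduct_sub, dotProduct_smul, smul_dotProduct, smul_eq_mul,
      dotProduct_comm w a, haa]
    generalize a ⬝ᵥ w = p
    rw [hc]
    field_simp
    ring

lemma lintegral_edgeDet_section {d : ℕ} (β κ b : ℝ) (a : Fin d → ℝ) :
    ∫⁻ Y : Fin (d + 1) → Fin d → ℝ, ENNReal.ofReal (|edgeDet Y| ^ κ) *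
        ∏ i, betaProfile β (Y i ⬝ᵥ Y i + (b + Y i ⬝ᵥ a) ^ 2) =
      ENNReal.ofReal (√(1 + a ⬝ᵥ a) ^ (-(d + 1 + κ))) *
        betaProfile (((d : ℝ) + 1) * β + d * (d + 1) / 2 + d * κ / 2)
          ((b / √(1 + a ⬝ᵥ a)) ^ 2) * simplexMoment d β κ := by
  obtain ⟨B, hBdet, hB⟩ := exists_section_parametrization a
  have h0 : 0 ≤ a ⬝ᵥ a := Finset.sum_nonneg fun i _ => mul_self_nonneg _
  set σ := √(1 + a ⬝ᵥ a) with hσ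
  have hσ0 : 0 < σ := Real.sqrt_pos.2 (by linarith)
  have haa : a ⬝ᵥ a = σ ^ 2 - 1 := by rw [hσ, Real.sq_sqrt (by linarith)]; ring
  have hB0 : B.det ≠ 0 := by rw [hBdet]; positivity
  set v : Fin d → ℝ := (-(b / σ ^ 2)) • a with hv
  set h := (b / σ) ^ 2 with hh
  have hsq : ∀ w, (v + B.mulVec w) ⬝ᵥ (v + B.mulVec w) + (b + (v + B.mulVec w) ⬝ᵥ a) ^ 2 =
      h + w ⬝ᵥ w := by
    intro w
    rw [← hB w]
    simp only [hv, add_dotProduct, dotProduct_add, dotProduct_smul, smul_dotProduct, smul_eq_mul,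
      dotProduct_comm (B.mulVec w) a, haa, hh]
    generalize a ⬝ᵥ B.mulVec w = p
    field_simp
    ring
  rw [lintegral_comp_affine_rows hB0 v]
  simp_rw [hsq, edgeDet_affine, abs_mul]
  simp_rw [Real.mul_rpow (abs_nonneg B.det) (abs_nonneg _),
    ENNReal.ofReal_mul (Real.rpow_nonneg (abs_nonneg B.det) κ), mul_assoc]
  rw [lintegral_const_mul' _ _ ENNReal.ofReal_ne_top, ← mul_assoc,
    ← ENNReal.ofReal_mul (by positivity), hBdet, abs_of_pos (inv_pos.2 hσ0)]
  have hσpow : σ⁻¹ ^ (d + 1) * σ⁻¹ ^ κ = σ ^ (-((d : ℝ) + 1 + κ)) := by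
    rw [← Real.rpow_natCast, ← Real.rpow_add (inv_pos.2 hσ0), Real.inv_rpow hσ0.le,
      Real.rpow_neg hσ0.le]
    push_cast
    rfl
  rw [hσpow]
  congr 1
  by_cases h1 : h < 1
  · have hr : 0 < 1 - h := by linarith
    set r := √(1 - h) with hr'
    have hr0 : 0 < r := Real.sqrt_pos.2 hr
    have hdet : (r • (1 : Matrix (Fin d) (Fin d) ℝ)).det = r ^ d := by simp
    have hsc : ∀ w : Fin d → ℝ, h + (0 + (r • (1 : Matrix (Fin d) (Fin d) ℝ)).mulVec w) ⬝ᵥ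
        (0 + (r • (1 : Matrix (Fin d) (Fin d) ℝ)).mulVec w) = h + (1 - h) * (w ⬝ᵥ w) := by
      intro w
      rw [zero_add, Matrix.smul_mulVec, Matrix.one_mulVec, dotProduct_smul, smul_dotProduct,
        smul_eq_mul, smul_eq_mul, ← mul_assoc, Real.mul_self_sqrt hr.le]
    rw [lintegral_comp_affine_rows (C := r • 1) (by rw [hdet]; positivity) 0]
    simp_rw [edgeDet_affine, hdet, hsc, betaProfile_scale β h1, Finset.prod_mul_distrib, abs_mul,
      Real.mul_rpow (abs_nonneg (r ^ d)) (abs_nonneg _),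
      ENNReal.ofReal_mul (Real.rpow_nonneg (abs_nonneg (r ^ d)) κ)]
    simp_rw [mul_assoc, mul_left_comm _ (∏ _ : Fin (d + 1), ENNReal.ofReal ((1 - h) ^ β))]
    rw [lintegral_const_mul' _ _ (by
      rw [Finset.prod_const]; exact ENNReal.pow_ne_top ENNReal.ofReal_ne_top),
      lintegral_const_mul' _ _ ENNReal.ofReal_ne_top, simplexMoment, ← mul_assoc, ← mul_assoc]
    congr 1
    rw [Finset.prod_const, Finset.card_univ, Fintype.card_fin,
      ← ENNReal.ofReal_pow (by positivity), ← ENNReal.ofReal_mul (by positivity),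
      ← ENNReal.ofReal_mul (by positivity), betaProfile, if_pos h1]
    congr 1
    rw [abs_of_pos (by positivity), hr', Real.sqrt_eq_rpow]
    simp only [← Real.rpow_natCast, ← Real.rpow_mul hr.le, ← Real.rpow_add hr]
    push_cast
    ring_nf
  · rw [betaProfile_of_one_le (not_lt.1 h1), zero_mul]
    refine (lintegral_congr fun W => ?_).trans lintegral_zero
    rw [Fin.prod_univ_succ, betaProfile_of_one_le, zero_mul, mul_zero]
    have : 0 ≤ W 0 ⬝ᵥ W 0 := Finset.sum_nonneg fun i _ => mul_self_nonneg _
    linarith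

lemma measurable_sectionIntegrand (d : ℕ) (β κ : ℝ) :
    Measurable fun p : (Fin (d + 1) → Fin d → ℝ) × (Fin (d + 1) → ℝ) =>
      ENNReal.ofReal (|p.2 0| ^ (κ - 1)) * (ENNReal.ofReal (|edgeDet p.1| ^ κ) *
        ∏ i, betaProfile β (p.1 i ⬝ᵥ p.1 i + (p.2 0 + p.1 i ⬝ᵥ fun j => p.2 j.succ) ^ 2)) := by
  have hd := measurable_dotProduct_self d
  have he : Measurable fun Y : Fin (d + 1) → Fin d → ℝ => |edgeDet Y| :=
    continuous_abs.measurable.comp (measurable_edgeDet d)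
  have hsnd : ∀ i : Fin (d + 1), Measurable fun p : (Fin (d + 1) → Fin d → ℝ) ×
      (Fin (d + 1) → ℝ) => p.2 i := fun i => (measurable_pi_apply i).comp measurable_snd
  have hfst : ∀ i : Fin (d + 1), Measurable fun p : (Fin (d + 1) → Fin d → ℝ) ×
      (Fin (d + 1) → ℝ) => p.1 i := fun i => (measurable_pi_apply i).comp measurable_fst
  refine Measurable.mul ?_ (Measurable.mul ?_ (Finset.measurable_prod _ fun i _ => ?_))
  · exact ((continuous_abs.measurable.comp (hsnd 0)).pow_const _).ennreal_ofReal
  · exact ((he.comp measurable_fst).pow_const _).ennreal_ofReal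
  · refine (measurable_betaProfile β).comp (Measurable.add (hd.comp (hfst i))
      (Measurable.pow_const (Measurable.add (hsnd 0) ?_) _))
    exact Finset.measurable_sum _ fun j _ =>
      ((measurable_pi_apply j).comp (hfst i)).mul (hsnd j.succ)

lemma detMoment_eq_simplexMoment_mul (d : ℕ) {β κ : ℝ} (hκ : 0 < κ)
    (hN : -1 < ((d : ℝ) + 1) * β + d * (d + 1) / 2 + d * κ / 2) :
    detMoment (d + 1) β (κ - 1) = simplexMoment d β κ *
      ENNReal.ofReal (Real.pi ^ (((d : ℝ) + 1) / 2) / Real.Gamma (((d : ℝ) + 1) / 2) *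
        (Real.Gamma (κ / 2) *
          Real.Gamma (((d : ℝ) + 1) * β + d * (d + 1) / 2 + d * κ / 2 + 1) /
          Real.Gamma (κ / 2 + (((d : ℝ) + 1) * β + d * (d + 1) / 2 + d * κ / 2 + 1)))) := by
  set N := ((d : ℝ) + 1) * β + d * (d + 1) / 2 + d * κ / 2 with hNdef
  have hd := measurable_dotProduct_self d
  have hb := measurable_betaProfile β
  have hbN := measurable_betaProfile N
  have he : Measurable fun Y : Fin (d + 1) → Fin d → ℝ => |edgeDet Y| :=
    continuous_abs.measurable.comp (measurable_edgeDet d)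
  have g1 := Real.Gamma_pos_of_pos (by positivity : 0 < ((d : ℝ) + 1) / 2)
  rw [detMoment, lintegral_split_first_column (measurable_detMoment_integrand _ _ _)]
  have key : ∀ᵐ Y : Fin (d + 1) → Fin d → ℝ, ∫⁻ z : Fin (d + 1) → ℝ,
      ENNReal.ofReal
        (|(Matrix.of fun i => (Fin.cons (z i) (Y i) : Fin (d + 1) → ℝ)).det| ^ (κ - 1)) *
        ∏ i, betaProfile β ((Fin.cons (z i) (Y i) : Fin (d + 1) → ℝ) ⬝ᵥ
          (Fin.cons (z i) (Y i) : Fin (d + 1) → ℝ)) =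
      ∫⁻ w : Fin (d + 1) → ℝ, ENNReal.ofReal (|w 0| ^ (κ - 1)) *
        (ENNReal.ofReal (|edgeDet Y| ^ κ) *
          ∏ i, betaProfile β (Y i ⬝ᵥ Y i + (w 0 + Y i ⬝ᵥ fun j => w j.succ) ^ 2)) := by
    filter_upwards [ae_edgeDet_ne_zero d] with Y hY
    have hP := det_cons_one Y
    rw [lintegral_comp_mulVec (P := Matrix.of fun i => (Fin.cons 1 (Y i) : Fin (d + 1) → ℝ))
      (by rwa [hP]), hP, ← lintegral_const_mul' _ _ ENNReal.ofReal_ne_top]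
    refine lintegral_congr fun w => ?_
    have hw : ∀ i, (Matrix.of fun i => (Fin.cons 1 (Y i) : Fin (d + 1) → ℝ)).mulVec w i =
        w 0 + Y i ⬝ᵥ fun j => w j.succ := fun i => by
      simp [Matrix.mulVec, dotProduct, Fin.sum_univ_succ]
    rw [det_cons_mulVec]
    simp_rw [dotProduct_cons_self, hw]
    rw [← mul_assoc, ← mul_assoc]
    congr 1
    rw [← ENNReal.ofReal_mul (abs_nonneg _), ← ENNReal.ofReal_mul (by positivity), abs_mul,
      Real.mul_rpow (abs_nonneg _) (abs_nonneg _), Real.rpow_sub_one (abs_ne_zero.2 hY)]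
    congr 1
    have := abs_ne_zero.2 hY
    field_simp
  rw [lintegral_congr_ae key,
    lintegral_lintegral_swap (measurable_sectionIntegrand d β κ).aemeasurable]
  simp_rw [lintegral_const_mul' _ _ ENNReal.ofReal_ne_top, lintegral_edgeDet_section]
  have hσm : Measurable fun a : Fin d → ℝ => √(1 + a ⬝ᵥ a) := by fun_prop
  have hσm' : Measurable fun w : Fin (d + 1) → ℝ =>
      √(1 + (fun j => w (Fin.succ j)) ⬝ᵥ (fun j => w (Fin.succ j))) :=
    hσm.comp (f := fun w : Fin (d + 1) → ℝ => fun j => w (Fin.succ j)) (by fun_prop)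
  rw [lintegral_fin_cons (by fun_prop)]
  simp only [Fin.cons_zero, Fin.cons_succ]
  rw [lintegral_lintegral_swap (by fun_prop), ENNReal.ofReal_mul (by positivity),
    ← lintegral_inv_sqrt_pow, ← lintegral_mul_const _ (by fun_prop),
    ← lintegral_const_mul _ (by fun_prop)]
  refine lintegral_congr fun a => ?_
  have h0 : 0 ≤ a ⬝ᵥ a := Finset.sum_nonneg fun i _ => mul_self_nonneg _
  set σ := √(1 + a ⬝ᵥ a) with hσ
  have hσ0 : 0 < σ := Real.sqrt_pos.2 (by linarith)
  have h1 := lintegral_abs_rpow_mul_betaProfile (p := κ - 1) (by linarith) hN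
  rw [sub_add_cancel] at h1
  rw [← h1, lintegral_comp_mul_right_of_pos _ hσ0, ← mul_assoc (simplexMoment d β κ),
    ← lintegral_const_mul _ (by fun_prop), ← lintegral_const_mul _ (by fun_prop)]
  refine lintegral_congr fun t => ?_
  rw [mul_div_cancel_left₀ _ hσ0.ne', abs_mul, abs_of_pos hσ0,
    Real.mul_rpow hσ0.le (abs_nonneg t), ENNReal.ofReal_mul (by positivity)]
  have hpow : ENNReal.ofReal ((σ ^ (d + 1))⁻¹) = ENNReal.ofReal σ * ENNReal.ofReal (σ ^ (κ - 1)) *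
      ENNReal.ofReal (σ ^ (-((d : ℝ) + 1 + κ))) := by
    rw [← ENNReal.ofReal_mul (by positivity), ← ENNReal.ofReal_mul (by positivity)]
    congr 1
    nth_rewrite 2 [← Real.rpow_one σ]
    rw [← Real.rpow_add hσ0, ← Real.rpow_add hσ0, ← Real.rpow_natCast, ← Real.rpow_neg hσ0.le]
    push_cast
    ring_nf
  rw [hpow]
  ring

lemma simplexMoment_zero (d : ℕ) {β : ℝ} (hβ : -1 < β) :
    simplexMoment d β 0 = ENNReal.ofReal
      ((Real.pi ^ ((d : ℝ) / 2) * Real.Gamma (β + 1) / Real.Gamma ((d : ℝ) / 2 + β + 1)) ^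
        (d + 1)) := by
  have hm : Measurable fun x : Fin d → ℝ => betaProfile β (x ⬝ᵥ x) :=
    (measurable_betaProfile β).comp (measurable_dotProduct_self d)
  have g1 := Real.Gamma_pos_of_pos (by linarith : 0 < β + 1)
  have g2 := Real.Gamma_pos_of_pos (add_pos_of_nonneg_of_pos (by positivity) (by linarith) :
    0 < (d : ℝ) / 2 + (β + 1))
  simp only [simplexMoment, Real.rpow_zero, ENNReal.ofReal_one, one_mul]
  rw [lintegral_fin_prod fun _ => hm, Finset.prod_const, lintegral_betaProfile_dotProduct d hβ,
    Finset.card_univ, Fintype.card_fin, ← ENNReal.ofReal_pow]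
  rw [add_assoc]
  positivity

lemma simplexMoment_eq {d : ℕ} (hd : 1 ≤ d) {β κ : ℝ} (hβ : -1 < β) (hκ : 0 ≤ κ) :
    simplexMoment d β κ = ENNReal.ofReal
      (Real.pi ^ ((d : ℝ) * (d + 1) / 2) *
        (Real.Gamma (β + 1) / Real.Gamma (((d : ℝ) + κ) / 2 + β + 1)) ^ (d + 1) *
        (Real.Gamma (((d : ℝ) + 1) / 2 * (2 * β + d + κ) + 1) /
          Real.Gamma (((d : ℝ) + 1) / 2 * (2 * β + d) + (d : ℝ) * κ / 2 + 1)) *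
        ∏ i ∈ Finset.Icc 1 d,
          Real.Gamma (((i : ℝ) + κ) / 2) / Real.Gamma ((i : ℝ) / 2)) := by
  have hd1 : (1 : ℝ) ≤ d := by exact_mod_cast hd
  rcases hκ.eq_or_lt with rfl | hκ
  · rw [simplexMoment_zero d hβ]
    congr 1
    have hN : 0 < ((d : ℝ) + 1) / 2 * (2 * β + d) + 1 := by nlinarith
    rw [Finset.prod_congr rfl (g := fun _ => (1 : ℝ)) fun i hi => ?_]
    · simp only [add_zero, mul_zero, zero_div, Finset.prod_const_one, mul_one]
      rw [div_self (Real.Gamma_pos_of_pos hN).ne', mul_one, mul_div_assoc, mul_pow,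
        ← Real.rpow_natCast (_ ^ _), ← Real.rpow_mul Real.pi_pos.le]
      push_cast
      ring_nf
    · have : (0 : ℝ) < i := by exact_mod_cast (Finset.mem_Icc.1 hi).1
      rw [add_zero, div_self (Real.Gamma_pos_of_pos (by positivity)).ne']
  · have hN : 0 < ((d : ℝ) + 1) / 2 * (2 * β + d) + d * κ / 2 + 1 := by
      nlinarith [mul_pos (by linarith : (0 : ℝ) < d) hκ]
    have hM : ((d : ℝ) + 1) / 2 * (2 * β + d) + d * κ / 2 + 1 =
        ((d : ℝ) + 1) * β + d * (d + 1) / 2 + d * κ / 2 + 1 := by ring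
    have hM2 : κ / 2 + (((d : ℝ) + 1) * β + d * (d + 1) / 2 + d * κ / 2 + 1) =
        ((d : ℝ) + 1) / 2 * (2 * β + d + κ) + 1 := by ring
    have hM3 : 0 < ((d : ℝ) + 1) / 2 * (2 * β + d + κ) + 1 := by
      nlinarith [mul_pos (by linarith : (0 : ℝ) < d) hκ]
    have g1 := Real.Gamma_pos_of_pos (by positivity : 0 < ((d : ℝ) + 1) / 2)
    have g2 := Real.Gamma_pos_of_pos (by positivity : 0 < κ / 2)
    have g3 := Real.Gamma_pos_of_pos hN
    have g4 := Real.Gamma_pos_of_pos hM3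
    have h := detMoment_eq_simplexMoment_mul d (β := β) hκ (by linarith)
    rw [detMoment_eq _ hβ (by linarith), hM2, ← hM, eq_comm] at h
    rw [eq_ofReal_div_of_mul_eq (by positivity) h]
    congr 1
    have hpi : Real.pi ^ (((d + 1 : ℕ) : ℝ) ^ 2 / 2) =
        Real.pi ^ ((d : ℝ) * (d + 1) / 2) * Real.pi ^ (((d : ℝ) + 1) / 2) := by
      rw [← Real.rpow_add Real.pi_pos]
      push_cast
      ring_nf
    have hprod : ∏ i ∈ Finset.range (d + 1),
        Real.Gamma (((i : ℝ) + 1 + (κ - 1)) / 2) / Real.Gamma (((i : ℝ) + 1) / 2) =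
        Real.Gamma (κ / 2) / Real.Gamma (((d : ℝ) + 1) / 2) * ∏ i ∈ Finset.Icc 1 d,
          Real.Gamma (((i : ℝ) + κ) / 2) / Real.Gamma ((i : ℝ) / 2) := by
      rw [Finset.prod_div_distrib, Finset.prod_range_succ', Finset.prod_range_succ,
        Finset.prod_div_distrib, ← Finset.Ico_add_one_right_eq_Icc, Finset.prod_Ico_eq_prod_range,
        Finset.prod_Ico_eq_prod_range, add_tsub_cancel_right]
      push_cast
      simp only [zero_add, add_comm (1 : ℝ)]
      rw [mul_comm, mul_comm (∏ _ ∈ _, _) (Real.Gamma (((d : ℝ) + 1) / 2)), mul_div_mul_comm]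
      congr 3
      · ring
      · funext i
        ring_nf
    have hexp : (((d + 1 : ℕ) : ℝ) + (κ - 1)) / 2 + β + 1 = ((d : ℝ) + κ) / 2 + β + 1 := by
      push_cast
      ring
    rw [hprod, hpi, hexp]
    field_simp

/-- The real-valued integrand of `simplexMoment`. -/
noncomputable def simplexIntegrand {d : ℕ} (β κ : ℝ) (Y : Fin (d + 1) → Fin d → ℝ) : ℝ :=
  |edgeDet Y| ^ κ * ∏ i, if Y i ⬝ᵥ Y i < 1 then (1 - Y i ⬝ᵥ Y i) ^ β else 0

lemma integral_simplexIntegrand (d : ℕ) (β κ : ℝ) :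
    ∫ Y : Fin (d + 1) → Fin d → ℝ, simplexIntegrand β κ Y = (simplexMoment d β κ).toReal := by
  have hd := measurable_dotProduct_self d
  have hp : ∀ (Y : Fin (d + 1) → Fin d → ℝ) (i : Fin (d + 1)),
      0 ≤ if Y i ⬝ᵥ Y i < 1 then (1 - Y i ⬝ᵥ Y i) ^ β else 0 := fun Y i => by
    split_ifs with h
    · exact Real.rpow_nonneg (by linarith) _
    · rfl
  have hm : Measurable (simplexIntegrand (d := d) β κ) := by
    refine Measurable.mul ?_ (Finset.measurable_prod _ fun i _ => ?_)
    · exact (continuous_abs.measurable.comp (measurable_edgeDet d)).pow_const _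
    · have hi : Measurable fun Y : Fin (d + 1) → Fin d → ℝ => Y i ⬝ᵥ Y i :=
        hd.comp (measurable_pi_apply i)
      exact Measurable.ite (measurableSet_lt hi measurable_const)
        ((hi.const_sub 1).pow_const β) measurable_const
  rw [integral_eq_lintegral_of_nonneg_ae _ hm.aestronglyMeasurable]
  · congr 1
    refine lintegral_congr fun Y => ?_
    rw [simplexIntegrand, ENNReal.ofReal_mul (Real.rpow_nonneg (abs_nonneg _) _),
      ENNReal.ofReal_prod_of_nonneg fun i _ => hp Y i]
    rfl
  · exact .of_forall fun Y =>
      mul_nonneg (Real.rpow_nonneg (abs_nonneg _) _) (Finset.prod_nonneg fun i _ => hp Y i)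

lemma integral_comp_ofLp {d n : ℕ} (G : (Fin n → Fin d → ℝ) → ℝ) :
    ∫ X : Fin n → EuclideanSpace ℝ (Fin d), G (fun i => (X i).ofLp) = ∫ Y, G Y :=
  (volume_preserving_pi (fun _ : Fin n =>
      EuclideanSpace.volume_preserving_symm_measurableEquiv_toLp (Fin d))).integral_comp
    (MeasurableEquiv.piCongrRight fun _ : Fin n =>
      (MeasurableEquiv.toLp 2 (Fin d → ℝ)).symm).measurableEmbedding G

/-- Miles' formula: moments of the volume of the random simplex spanned by `d+1`
i.i.d. beta-distributed points in the unit ball of `ℝ^d`. -/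

theorem beta_simplex_moments (d : ℕ) (hd : 1 ≤ d) (β : ℝ) (hβ : -1 < β)
    (κ : ℝ) (hκ : 0 ≤ κ) :
    ∫ X : Fin (d + 1) → EuclideanSpace ℝ (Fin d),
      (|(Matrix.of fun i j : Fin d => X i.succ j - X 0 j).det| / (Nat.factorial d : ℝ)) ^ κ *
        ∏ i : Fin (d + 1),
          (if ‖X i‖ < 1 then
            (Real.Gamma ((d : ℝ) / 2 + β + 1) / (Real.pi ^ ((d : ℝ) / 2) * Real.Gamma (β + 1))) *
              (1 - ‖X i‖ ^ 2) ^ β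
           else 0)
    = ((Nat.factorial d : ℝ)) ^ (-κ) *
        (Real.Gamma (((d : ℝ) + 1) / 2 * (2 * β + d + κ) + 1) /
          Real.Gamma (((d : ℝ) + 1) / 2 * (2 * β + d) + (d : ℝ) * κ / 2 + 1)) *
        (Real.Gamma ((d : ℝ) / 2 + β + 1) / Real.Gamma (((d : ℝ) + κ) / 2 + β + 1)) ^ (d + 1) *
        ∏ i ∈ Finset.Icc 1 d,
          Real.Gamma (((i : ℝ) + κ) / 2) / Real.Gamma ((i : ℝ) / 2) := by
  have hd1 : (1 : ℝ) ≤ d := by exact_mod_cast hd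
  set c := Real.Gamma ((d : ℝ) / 2 + β + 1) / (Real.pi ^ ((d : ℝ) / 2) * Real.Gamma (β + 1)) with hc
  have hX : ∀ X : Fin (d + 1) → EuclideanSpace ℝ (Fin d),
      (|(Matrix.of fun i j : Fin d => X i.succ j - X 0 j).det| / (Nat.factorial d : ℝ)) ^ κ *
        ∏ i : Fin (d + 1), (if ‖X i‖ < 1 then c * (1 - ‖X i‖ ^ 2) ^ β else 0) =
      (Nat.factorial d : ℝ) ^ (-κ) * c ^ (d + 1) *
        simplexIntegrand β κ (fun i => (X i).ofLp) := by
    intro X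
    have hn : ∀ i, ‖X i‖ ^ 2 = (X i).ofLp ⬝ᵥ (X i).ofLp := fun i => by
      rw [EuclideanSpace.real_norm_sq_eq]
      exact Finset.sum_congr rfl fun j _ => sq _
    have hf : ∀ i, (if ‖X i‖ < 1 then c * (1 - ‖X i‖ ^ 2) ^ β else 0) =
        c * if (X i).ofLp ⬝ᵥ (X i).ofLp < 1 then
          (1 - (X i).ofLp ⬝ᵥ (X i).ofLp) ^ β else 0 := fun i => by
      rw [mul_ite, mul_zero, ← hn]
      simp only [sq_lt_one_iff₀ (norm_nonneg _)]
    simp_rw [hf, Finset.prod_mul_distrib]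
    rw [Finset.prod_const, Finset.card_univ, Fintype.card_fin,
      Real.div_rpow (abs_nonneg _) (Nat.cast_nonneg _), Real.rpow_neg (Nat.cast_nonneg _),
      simplexIntegrand, edgeDet]
    ring
  simp_rw [hX]
  have g1 := Real.Gamma_pos_of_pos (by linarith : 0 < β + 1)
  have g2 := Real.Gamma_pos_of_pos (by linarith : 0 < ((d : ℝ) + κ) / 2 + β + 1)
  have g3 := Real.Gamma_pos_of_pos
    (by nlinarith : 0 < ((d : ℝ) + 1) / 2 * (2 * β + d + κ) + 1)
  have g4 := Real.Gamma_pos_of_pos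
    (by nlinarith : 0 < ((d : ℝ) + 1) / 2 * (2 * β + d) + d * κ / 2 + 1)
  have hprod : 0 ≤ ∏ i ∈ Finset.Icc 1 d,
      Real.Gamma (((i : ℝ) + κ) / 2) / Real.Gamma ((i : ℝ) / 2) :=
    Finset.prod_nonneg fun i _ => div_nonneg (Real.Gamma_nonneg_of_nonneg (by positivity))
      (Real.Gamma_nonneg_of_nonneg (by positivity))
  have hpi : (Real.pi ^ ((d : ℝ) / 2)) ^ (d + 1) = Real.pi ^ ((d : ℝ) * (d + 1) / 2) := by
    rw [← Real.rpow_natCast (_ ^ _), ← Real.rpow_mul Real.pi_pos.le]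
    push_cast
    ring_nf
  rw [integral_const_mul, integral_comp_ofLp, integral_simplexIntegrand,
    simplexMoment_eq hd hβ hκ, ENNReal.toReal_ofReal (by positivity), hc]
  simp only [div_pow, mul_pow, hpi]
  field_simp
end
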